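/- arXiv:math-ph/0208041 — 15 statements merged into one kernel-verified Lean document; each statement's English description precedes it below -/
import Mathlib

section
/- The set of functions ψ : ℤ×ℤ → ℝ satisfying both Qψ = 0 and Q⁺ψ = 0 (the covariant constants of the canonical connection on the equilateral triangular lattice) is an ℝ-linear subspace of the space of all functions ℤ×ℤ → ℝ of dimension exactly 2. -/
/-- The white-triangle operator `Q` as an `ℝ`-linear endomorphism of the space of
functions `ℤ × ℤ → ℝ`:  `(Qψ)(n₁,n₂) = ψ(n₁,n₂) + ψ(n₁+1,n₂) + ψ(n₁,n₂+1)`. -/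
def Qlin : Module.End ℝ ((ℤ × ℤ) → ℝ) where
  toFun ψ := fun n => ψ n + ψ (n.1 + 1, n.2) + ψ (n.1, n.2 + 1)
  map_add' φ ψ := by funext n; simp [Pi.add_apply]; ring
  map_smul' c ψ := by funext n; simp [Pi.smul_apply, smul_eq_mul]; ring

/-- The black-triangle operator `Q⁺` (the formal adjoint of `Q`):
`(Q⁺ψ)(n₁,n₂) = ψ(n₁,n₂) + ψ(n₁−1,n₂) + ψ(n₁,n₂−1)`. -/
def Qplin : Module.End ℝ ((ℤ × ℤ) → ℝ) where
  toFun ψ := fun n => ψ n + ψ (n.1 - 1, n.2) + ψ (n.1, n.2 - 1)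
  map_add' φ ψ := by funext n; simp [Pi.add_apply]; ring
  map_smul' c ψ := by funext n; simp [Pi.smul_apply, smul_eq_mul]; ring

theorem mem_ker_Qlin_inf_ker_Qplin {ψ : ℤ × ℤ → ℝ} :
    ψ ∈ LinearMap.ker Qlin ⊓ LinearMap.ker Qplin ↔
      (∀ a b : ℤ, ψ (a, b) + ψ (a + 1, b) + ψ (a, b + 1) = 0) ∧
        ∀ a b : ℤ, ψ (a, b) + ψ (a - 1, b) + ψ (a, b - 1) = 0 := by
  simp [Submodule.mem_inf, LinearMap.mem_ker, Qlin, Qplin, funext_iff]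

/-- A covariant constant satisfies a second-order recurrence along rows. -/
theorem row_recurrence {ψ : ℤ × ℤ → ℝ}
    (hQ : ∀ a b : ℤ, ψ (a, b) + ψ (a + 1, b) + ψ (a, b + 1) = 0)
    (hP : ∀ a b : ℤ, ψ (a, b) + ψ (a - 1, b) + ψ (a, b - 1) = 0) (a b : ℤ) :
    ψ (a, b) + ψ (a + 1, b) + ψ (a + 1 + 1, b) = 0 := by
  have h₁ := hQ (a + 1) b
  have h₂ := hP (a + 1) (b + 1)
  have h₃ := hQ a b
  simp only [add_sub_cancel_right] at h₂
  linarith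

/-- A covariant constant vanishing at `(0, 0)` and `(1, 0)` is zero. -/
theorem eq_zero_of_initial_values {ψ : ℤ × ℤ → ℝ}
    (hQ : ∀ a b : ℤ, ψ (a, b) + ψ (a + 1, b) + ψ (a, b + 1) = 0)
    (hP : ∀ a b : ℤ, ψ (a, b) + ψ (a - 1, b) + ψ (a, b - 1) = 0)
    (h₀ : ψ (0, 0) = 0) (h₁ : ψ (1, 0) = 0) : ψ = 0 := by
  have row : ∀ a : ℤ, ψ (a, 0) = 0 ∧ ψ (a + 1, 0) = 0 := by
    intro a
    induction a using Int.induction_on with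
    | zero => simpa using ⟨h₀, h₁⟩
    | succ k ih =>
      have := row_recurrence hQ hP k 0
      exact ⟨ih.2, by linarith [ih.1, ih.2]⟩
    | pred k ih =>
      have := row_recurrence hQ hP (-k - 1) 0
      simp only [sub_add_cancel] at this ⊢
      exact ⟨by linarith [ih.1, ih.2], ih.1⟩
  have all : ∀ b a : ℤ, ψ (a, b) = 0 := by
    intro b
    induction b using Int.induction_on with
    | zero => exact fun a => (row a).1
    | succ k ih => exact fun a => by linarith [hQ a k, ih a, ih (a + 1)]
    | pred k ih => exact fun a => by linarith [hP a (-k), ih a, ih (a - 1)]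
  funext ⟨a, b⟩
  exact all b a

/-- The function of `(n₁ - n₂) mod 3` with values `x`, `y`, `-x - y`. -/
noncomputable def periodicSolution (x y : ℝ) (n : ℤ × ℤ) : ℝ :=
  if (n.1 - n.2) % 3 = 0 then x else if (n.1 - n.2) % 3 = 1 then y else -x - y

theorem periodicSolution_mem (x y : ℝ) :
    periodicSolution x y ∈ LinearMap.ker Qlin ⊓ LinearMap.ker Qplin := by
  rw [mem_ker_Qlin_inf_ker_Qplin]
  constructor <;> intro a b <;> simp only [periodicSolution] <;> split_ifs <;>
    first | (exfalso; omega) | ring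

/-- Evaluation of a covariant constant at `(0, 0)` and `(1, 0)`. -/
def initialValues : ↥(LinearMap.ker Qlin ⊓ LinearMap.ker Qplin) →ₗ[ℝ] ℝ × ℝ :=
  ((LinearMap.proj (0, 0)).prod (LinearMap.proj (1, 0))).comp (Submodule.subtype _)

theorem initialValues_bijective : Function.Bijective initialValues := by
  constructor
  · rw [← LinearMap.ker_eq_bot, LinearMap.ker_eq_bot']
    rintro ⟨ψ, hψ⟩ h
    obtain ⟨h₀, h₁⟩ := Prod.ext_iff.mp h
    obtain ⟨hQ, hP⟩ := mem_ker_Qlin_inf_ker_Qplin.mp hψ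
    exact Subtype.ext (eq_zero_of_initial_values hQ hP h₀ h₁)
  · rintro ⟨x, y⟩
    exact ⟨⟨periodicSolution x y, periodicSolution_mem x y⟩, by
      simp [initialValues, periodicSolution]⟩

/-- The space of covariant constants of the canonical connection on the equilateral
triangular lattice, i.e. the solutions of `Qψ = 0` and `Q⁺ψ = 0`, form an
`ℝ`-linear subspace of dimension exactly `2`. -/
theorem covariant_constants_dim_two :
    Module.finrank ℝ ↥(LinearMap.ker Qlin ⊓ LinearMap.ker Qplin) = 2 := by
  rw [(LinearEquiv.ofBijective initialValues initialValues_bijective).finrank_eq]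
  simp
end

section
/- For a function φ : ℤ×ℤ → ℝ, the system of equations Qψ = φ, Q⁺ψ = 0 has a solution ψ : ℤ×ℤ → ℝ if and only if Q⁺φ = 0. In particular, Q maps the space H = {ψ | Q⁺ψ = 0} onto itself. -/
/-- The white-triangle operator: `(Qψ)(n₁,n₂) = ψ(n₁,n₂) + ψ(n₁+1,n₂) + ψ(n₁,n₂+1)`. -/
def Qop (ψ : ℤ × ℤ → ℝ) : ℤ × ℤ → ℝ :=
  fun n => ψ n + ψ (n.1 + 1, n.2) + ψ (n.1, n.2 + 1)

/-- The black-triangle operator (the formal adjoint of `Q`):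
`(Q⁺ψ)(n₁,n₂) = ψ(n₁,n₂) + ψ(n₁−1,n₂) + ψ(n₁,n₂−1)`. -/
def Qadj (ψ : ℤ × ℤ → ℝ) : ℤ × ℤ → ℝ :=
  fun n => ψ n + ψ (n.1 - 1, n.2) + ψ (n.1, n.2 - 1)

/-- A two-sided recursion with invertible steps has a solution with any prescribed value at `0`. -/
theorem exists_int_recursion {α : Type*} (e : ℤ → α ≃ α) (a : α) :
    ∃ f : ℤ → α, f 0 = a ∧ ∀ k, f (k + 1) = e k (f k) := by
  let p : ℕ → α := fun n => Nat.rec a (fun k x => e k x) n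
  let q : ℕ → α := fun n => Nat.rec a (fun k x => (e (-(k : ℤ) - 1)).symm x) n
  refine ⟨fun k => if 0 ≤ k then p k.toNat else q (-k).toNat, rfl, fun k => ?_⟩
  rcases lt_or_ge k 0 with hk | hk
  · obtain ⟨m, rfl⟩ : ∃ m : ℕ, k = -(m : ℤ) - 1 := ⟨(-k - 1).toNat, by omega⟩
    have hneg : ¬ (0 : ℤ) ≤ -(m : ℤ) - 1 := by omega
    have hm : (-(-(m : ℤ) - 1)).toNat = m + 1 := by omega
    have hq : q (m + 1) = (e (-(m : ℤ) - 1)).symm (q m) := rfl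
    simp only [if_neg hneg, hm, hq, Equiv.apply_symm_apply, sub_add_cancel, neg_neg,
      Int.toNat_natCast]
    split_ifs with h
    · obtain rfl : m = 0 := by omega
      rfl
    · rfl
  · lift k to ℕ using hk
    have hpos : (0 : ℤ) ≤ (k : ℤ) + 1 := by omega
    have hk : ((k : ℤ) + 1).toNat = k + 1 := by omega
    simp only [if_pos hpos, hk, Int.natCast_nonneg, if_true, Int.toNat_natCast]
    rfl

/-- The operator `1 + T + T²`, with `T` the shift, is surjective on two-sided sequences. -/
theorem exists_add_shift_add_shift_eq (b : ℤ → ℝ) :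
    ∃ g : ℤ → ℝ, ∀ n, g n + g (n + 1) + g (n + 2) = b n := by
  let e : ℤ → (ℝ × ℝ) ≃ (ℝ × ℝ) := fun n =>
    { toFun := fun v => (v.2, b n - v.1 - v.2)
      invFun := fun w => (b n - w.1 - w.2, w.1)
      left_inv := fun v => by ext <;> simp
      right_inv := fun w => Prod.ext rfl (show b n - (b n - w.1 - w.2) - w.1 = w.2 by ring) }
  obtain ⟨f, -, hf⟩ := exists_int_recursion e 0
  refine ⟨fun n => (f n).1, fun n => ?_⟩
  have h₁ : (f (n + 1)).1 = (f n).2 := by rw [hf]; rfl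
  have h₂ : (f (n + 2)).1 = b n - (f n).1 - (f n).2 := by
    rw [show n + 2 = n + 1 + 1 by ring, hf (n + 1), hf n]
    rfl
  simp only [h₁, h₂]
  ring

theorem Qadj_eq_zero_iff (ψ : ℤ × ℤ → ℝ) :
    Qadj ψ = 0 ↔ ∀ n k, ψ (n + 1, k + 1) + ψ (n, k + 1) + ψ (n + 1, k) = 0 := by
  refine ⟨fun h n k => ?_, fun h => funext fun ⟨n, k⟩ => ?_⟩
  · simpa [Qadj] using congrFun h (n + 1, k + 1)
  · simpa [Qadj] using h (n - 1) (k - 1)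

theorem Qadj_Qop_comm (ψ : ℤ × ℤ → ℝ) : Qadj (Qop ψ) = Qop (Qadj ψ) := by
  funext ⟨n, k⟩
  simp only [Qadj, Qop, sub_add_cancel, add_sub_cancel_right]
  ring

/-- Given `Q⁺φ = 0`, a solution of the system is built by rows: each row solves
`(1 + T₁ + T₁²)ψ = (1 + T₁)φ`, and `T₂ψ = T₁²ψ - T₁φ` passes from one row to the next. -/
theorem exists_Qop_eq_of_Qadj_eq_zero {φ : ℤ × ℤ → ℝ} (hφ : Qadj φ = 0) :
    ∃ ψ : ℤ × ℤ → ℝ, Qop ψ = φ ∧ Qadj ψ = 0 := by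
  rw [Qadj_eq_zero_iff] at hφ
  obtain ⟨g, hg⟩ := exists_add_shift_add_shift_eq fun n => φ (n, 0) + φ (n + 1, 0)
  let e : ℤ → (ℤ → ℝ) ≃ (ℤ → ℝ) := fun k =>
    { toFun := fun u n => u (n + 2) - φ (n + 1, k)
      invFun := fun v n => v (n - 2) + φ (n - 1, k)
      left_inv := fun u => by
        funext n
        simp [show n - 2 + 1 = n - 1 by ring]
      right_inv := fun v => by
        funext n
        simp [show n + 2 - 1 = n + 1 by ring] }
  obtain ⟨f, hf₀, hf⟩ := exists_int_recursion e g
  have hstep : ∀ k n, f (k + 1) n = f k (n + 2) - φ (n + 1, k) := fun k n => by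
    rw [hf]; rfl
  have hrow : ∀ k n, f k n + f k (n + 1) + f k (n + 2) = φ (n, k) + φ (n + 1, k) := by
    have hdefect : ∀ k n,
        f (k + 1) n + f (k + 1) (n + 1) + f (k + 1) (n + 2) - φ (n, k + 1) - φ (n + 1, k + 1) =
          f k (n + 2) + f k (n + 2 + 1) + f k (n + 2 + 2) - φ (n + 2, k) - φ (n + 2 + 1, k) := by
      intro k n
      rw [hstep, hstep, hstep, show n + 1 + 2 = n + 2 + 1 by ring,
        show n + 1 + 1 = n + 2 by ring]
      linarith [hφ n k]
    intro k
    induction k using Int.induction_on with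
    | zero => simpa [hf₀] using hg
    | succ i ih =>
      intro n
      linarith [hdefect i n, ih (n + 2)]
    | pred i ih =>
      intro n
      have h := hdefect (-(i : ℤ) - 1) (n - 2)
      have h' := ih (n - 2)
      simp only [sub_add_cancel] at h h'
      linarith
  refine ⟨fun p => f p.2 p.1, funext fun ⟨n, k⟩ => ?_, (Qadj_eq_zero_iff _).2 fun n k => ?_⟩
  · simp only [Qop, hstep]
    linarith [hrow k n]
  · have h := hrow k (n + 1)
    simp only [hstep]
    rw [show n + 1 + 2 = n + 3 by ring, show n + 1 + 1 = n + 2 by ring] at *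
    linarith

/-- The system `Qψ = φ`, `Q⁺ψ = 0` is solvable if and only if `Q⁺φ = 0`.
In particular, `Q` maps the space `H = {ψ | Q⁺ψ = 0}` onto itself. -/
theorem solvable_iff_holomorphic (φ : ℤ × ℤ → ℝ) :
    (∃ ψ : ℤ × ℤ → ℝ, Qop ψ = φ ∧ Qadj ψ = 0) ↔ Qadj φ = 0 := by
  refine ⟨?_, exists_Qop_eq_of_Qadj_eq_zero⟩
  rintro ⟨ψ, rfl, hψ⟩
  rw [Qadj_Qop_comm, hψ]
  funext n
  simp [Qop]
end

section
/- For every integer k ≥ 0, the space 𝒫ₖ of discrete polynomials of degree at most k is an ℝ-linear subspace of the space of all functions ℤ×ℤ → ℝ of dimension exactly 2k+2. -/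
/-- A recursion on `ℤ` by invertible steps has a solution with any prescribed initial value. -/
theorem exists_int_recurrence {M : Type*} (σ : ℤ → M ≃ M) (a : M) :
    ∃ w : ℤ → M, w 0 = a ∧ ∀ m, w (m + 1) = σ m (w m) := by
  let w : ℤ → M := fun m => Int.inductionOn' (motive := fun _ => M) m 0 a
    (fun k _ x => σ k x) (fun k _ x => (σ (k - 1)).symm x)
  refine ⟨w, Int.inductionOn'_self, fun m => ?_⟩
  rcases le_or_gt 0 m with hm | hm
  · exact Int.inductionOn'_add_one hm
  · have h : w (m + 1 - 1) = (σ (m + 1 - 1)).symm (w (m + 1)) :=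
      Int.inductionOn'_sub_one (by omega)
    rw [add_sub_cancel_right] at h
    rw [h, Equiv.apply_symm_apply]

theorem exists_three_term_sum_eq (f : ℤ → ℝ) :
    ∃ g : ℤ → ℝ, ∀ n, g n + g (n + 1) + g (n + 2) = f n := by
  obtain ⟨s, -, hs⟩ := exists_int_recurrence (M := ℝ × ℝ)
    (fun n => { toFun := fun p => (p.2, f n - p.1 - p.2)
                invFun := fun q => (f n - q.1 - q.2, q.1)
                left_inv := fun p => by ext <;> simp
                right_inv := fun q => by ext <;> simp; ring }) 0
  refine ⟨fun n => (s n).1, fun n => ?_⟩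
  have h₁ := hs n
  have h₂ := hs (n + 1)
  rw [add_assoc, one_add_one_eq_two] at h₂
  simp only [Equiv.coe_fn_mk] at h₁ h₂
  simp only [h₂, h₁]
  ring

/-- Given a right-hand side whose rows have vanishing three-term sums, `Q⁺ w = e` has a solution
with the same property. -/
theorem exists_Qplin_eq_of_three_term_sum_eq_zero (e : ℤ × ℤ → ℝ)
    (he : ∀ n m, e (n, m) + e (n + 1, m) + e (n + 2, m) = 0) :
    ∃ w : ℤ × ℤ → ℝ, (∀ n m, w (n, m) + w (n + 1, m) + w (n + 2, m) = 0) ∧ Qplin w = e := by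
  obtain ⟨w, h0, hw⟩ := exists_int_recurrence (M := ℤ → ℝ)
    (fun m => { toFun := fun v n => v (n - 1) - e (n - 1, m + 1)
                invFun := fun v n => v (n + 1) + e (n, m + 1)
                left_inv := fun v => by ext; simp
                right_inv := fun v => by ext; simp }) 0
  have hw' : ∀ m n, w (m + 1) (n + 1) = w m n - e (n, m + 1) := fun m n => by simp [hw m]
  have hP : ∀ m n, w m n + w m (n + 1) + w m (n + 2) = 0 := by
    intro m
    induction m using Int.induction_on with
    | zero => simp [h0]
    | succ i ih =>
      intro n
      have h₁ := hw' i (n - 1)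
      have h₂ := hw' i n
      have h₃ := hw' i (n + 1)
      have h₄ := he (n - 1) (i + 1)
      have h₅ := ih (n - 1)
      grind
    | pred i ih =>
      intro n
      have h₁ := hw' (-i - 1) n
      have h₂ := hw' (-i - 1) (n + 1)
      have h₃ := hw' (-i - 1) (n + 2)
      have h₄ := he n (-i)
      have h₅ := ih (n + 1)
      grind
  refine ⟨fun p => w p.2 p.1, fun n m => hP m n, ?_⟩
  funext ⟨n, m⟩
  have h₁ := hw' (m - 1) n
  have h₂ := hP m (n - 1)
  simp only [Qplin, LinearMap.coe_mk, AddHom.coe_mk]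
  grind

theorem commute_Qlin_Qplin : Commute Qlin Qplin := by
  refine LinearMap.ext fun ψ => funext fun ⟨n, m⟩ => ?_
  simp only [Qlin, Qplin, Module.End.mul_apply, LinearMap.coe_mk, AddHom.coe_mk,
    add_sub_cancel_right, sub_add_cancel]
  ring

theorem mapsTo_Qlin_ker_Qplin (ψ : ℤ × ℤ → ℝ) (hψ : ψ ∈ LinearMap.ker Qplin) :
    Qlin ψ ∈ LinearMap.ker Qplin := by
  rw [LinearMap.mem_ker] at hψ ⊢
  rw [← Module.End.mul_apply, ← commute_Qlin_Qplin.eq, Module.End.mul_apply, hψ, map_zero]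

theorem exists_mem_ker_Qplin_Qlin_eq (φ : ℤ × ℤ → ℝ) (hφ : Qplin φ = 0) :
    ∃ u, Qplin u = 0 ∧ Qlin u = φ := by
  choose g hg using fun m => exists_three_term_sum_eq fun n => φ (n, m)
  let v : ℤ × ℤ → ℝ := fun p => g p.2 p.1
  have hv : ∀ n m, v (n, m) + v (n + 1, m) + v (n + 2, m) = φ (n, m) := fun n m => hg m n
  have hφ' : ∀ n m, φ (n, m) + φ (n - 1, m) + φ (n, m - 1) = 0 := fun n m => congrFun hφ (n, m)
  obtain ⟨w, hw, hwv⟩ := exists_Qplin_eq_of_three_term_sum_eq_zero (Qplin v) fun n m => by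
    have h₁ := hv n m
    have h₂ := hv (n - 1) m
    have h₃ := hv n (m - 1)
    have h₄ := hφ' n m
    simp only [Qplin, LinearMap.coe_mk, AddHom.coe_mk]
    grind
  let t := v - w
  have ht : ∀ n m, t (n, m) + t (n + 1, m) + t (n + 2, m) = φ (n, m) := fun n m => by
    have h₁ := hv n m
    have h₂ := hw n m
    simp only [t, Pi.sub_apply]
    linarith
  have htQ : ∀ n m, t (n, m) + t (n - 1, m) + t (n, m - 1) = 0 := fun n m =>
    congrFun (show Qplin t = 0 by rw [map_sub, hwv, sub_self]) (n, m)
  refine ⟨fun p => t (p.1 + 1, p.2) + t p, ?_, ?_⟩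
  · funext ⟨n, m⟩
    have h₁ := htQ n m
    have h₂ := htQ (n + 1) m
    simp only [Qplin, LinearMap.coe_mk, AddHom.coe_mk, Pi.zero_apply]
    grind
  · funext ⟨n, m⟩
    have h₁ := htQ (n + 1) (m + 1)
    have h₂ := ht n m
    simp only [Qlin, LinearMap.coe_mk, AddHom.coe_mk]
    grind

theorem eq_zero_of_Qlin_Qplin_eq_zero {u : ℤ × ℤ → ℝ} (hQ : Qlin u = 0) (hQp : Qplin u = 0)
    (h0 : u (0, 0) = 0) (h1 : u (1, 0) = 0) : u = 0 := by
  have hQ' : ∀ n m, u (n, m) + u (n + 1, m) + u (n, m + 1) = 0 := fun n m => congrFun hQ (n, m)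
  have hQp' : ∀ n m, u (n, m) + u (n - 1, m) + u (n, m - 1) = 0 := fun n m => congrFun hQp (n, m)
  have hdiag : ∀ n m, u (n + 1, m + 1) = u (n, m) := fun n m => by
    have h₁ := hQ' n m
    have h₂ := hQp' (n + 1) (m + 1)
    grind
  have hP : ∀ n, u (n, 0) + u (n + 1, 0) + u (n + 2, 0) = 0 := fun n => by
    have h₁ := hQ' (n + 1) 0
    have h₂ := hdiag n 0
    grind
  have hrow : ∀ n, u (n, 0) = 0 ∧ u (n + 1, 0) = 0 := by
    intro n
    induction n using Int.induction_on with
    | zero => exact ⟨h0, by simpa using h1⟩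
    | succ i ih =>
      have := hP i
      grind
    | pred i ih =>
      have := hP (-i - 1)
      grind
  have hall : ∀ m n, u (n, m) = 0 := by
    intro m
    induction m using Int.induction_on with
    | zero => exact fun n => (hrow n).1
    | succ i ih =>
      intro n
      have := hdiag (n - 1) i
      grind
    | pred i ih =>
      intro n
      have := hdiag n (-i - 1)
      grind
  exact funext fun p => hall p.2 p.1

theorem exists_Qlin_Qplin_eq_zero (a b : ℝ) :
    ∃ u : ℤ × ℤ → ℝ, Qlin u = 0 ∧ Qplin u = 0 ∧ u (0, 0) = a ∧ u (1, 0) = b := by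
  refine ⟨fun p => if (p.1 - p.2) % 3 = 0 then a else if (p.1 - p.2) % 3 = 1 then b else -a - b,
    ?_, ?_, by simp, by simp⟩
  all_goals
    funext ⟨n, m⟩
    simp only [Qlin, Qplin, LinearMap.coe_mk, AddHom.coe_mk, Pi.zero_apply]
    split_ifs <;> first | omega | ring

/-- The iterated kernels of a surjective endomorphism grow by the rank of its kernel. -/
theorem Module.End.rank_ker_pow_of_surjective {K V : Type*} [DivisionRing K] [AddCommGroup V]
    [Module K V] {f : Module.End K V} (hf : Function.Surjective f) (k : ℕ) :
    Module.rank K (LinearMap.ker (f ^ k)) = k * Module.rank K (LinearMap.ker f) := by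
  induction k with
  | zero => simp [Module.End.one_eq_id, LinearMap.ker_id]
  | succ k ih =>
    have hmem : ∀ v ∈ LinearMap.ker (f ^ (k + 1)), f v ∈ LinearMap.ker (f ^ k) := fun v hv => by
      rwa [LinearMap.mem_ker, pow_succ, Module.End.mul_apply] at hv
    let g := f.restrict hmem
    have hg : Function.Surjective g := fun ⟨y, hy⟩ => by
      obtain ⟨x, rfl⟩ := hf y
      refine ⟨⟨x, ?_⟩, rfl⟩
      rwa [LinearMap.mem_ker, pow_succ, Module.End.mul_apply]
    have hle : LinearMap.ker f ≤ LinearMap.ker (f ^ (k + 1)) := fun v hv => by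
      rw [LinearMap.mem_ker] at hv
      rw [LinearMap.mem_ker, pow_succ, Module.End.mul_apply, hv, map_zero]
    have hker : LinearMap.ker g = (LinearMap.ker f).comap (LinearMap.ker (f ^ (k + 1))).subtype := by
      ext v
      simp [g, Subtype.ext_iff]
    rw [← LinearMap.rank_range_add_rank_ker g, LinearMap.range_eq_top.2 hg, rank_top, ih, hker,
      (Submodule.comapSubtypeEquivOfLe hle).rank_eq, Nat.cast_succ, add_mul, one_mul]

/-- The space `𝒫ₖ = {ψ | Q⁺ψ = 0 and Q^{k+1}ψ = 0}` of discrete polynomials of degree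
at most `k` is an `ℝ`-linear subspace of dimension exactly `2k + 2`. -/
theorem discrete_polynomials_dim (k : ℕ) :
    Module.finrank ℝ ↥(LinearMap.ker Qplin ⊓ LinearMap.ker (Qlin ^ (k + 1))) = 2 * k + 2 := by
  let f : Module.End ℝ (LinearMap.ker Qplin) := Qlin.restrict mapsTo_Qlin_ker_Qplin
  have hf : Function.Surjective f := fun ⟨φ, hφ⟩ => by
    obtain ⟨u, hu, rfl⟩ := exists_mem_ker_Qplin_Qlin_eq φ hφ
    exact ⟨⟨u, hu⟩, rfl⟩
  let ev : LinearMap.ker f →ₗ[ℝ] ℝ × ℝ :=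
    ((LinearMap.proj (0, 0)).prod (LinearMap.proj (1, 0))) ∘ₗ
      (LinearMap.ker Qplin).subtype ∘ₗ (LinearMap.ker f).subtype
  have hev : Function.Bijective ev := by
    constructor
    · rintro ⟨⟨u, hu⟩, hfu⟩ ⟨⟨v, hv⟩, hfv⟩ h
      have hfu' : Qlin u = 0 := congrArg Subtype.val hfu
      have hfv' : Qlin v = 0 := congrArg Subtype.val hfv
      have hz : u - v = 0 := eq_zero_of_Qlin_Qplin_eq_zero
        (by rw [map_sub, hfu', hfv', sub_zero])
        (by rw [map_sub, LinearMap.mem_ker.1 hu, LinearMap.mem_ker.1 hv, sub_zero])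
        (sub_eq_zero.2 (congrArg Prod.fst h)) (sub_eq_zero.2 (congrArg Prod.snd h))
      exact Subtype.ext (Subtype.ext (sub_eq_zero.1 hz))
    · rintro ⟨a, b⟩
      obtain ⟨u, hQ, hQp, rfl, rfl⟩ := exists_Qlin_Qplin_eq_zero a b
      exact ⟨⟨⟨u, hQp⟩, Subtype.ext hQ⟩, rfl⟩
  have hrank : Module.rank ℝ (LinearMap.ker f) = 2 := by
    rw [(LinearEquiv.ofBijective ev hev).rank_eq, rank_prod', Module.rank_self, one_add_one_eq_two]
  have hmap : LinearMap.ker Qplin ⊓ LinearMap.ker (Qlin ^ (k + 1)) =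
      (LinearMap.ker (f ^ (k + 1))).map (LinearMap.ker Qplin).subtype := by
    have hpow : f ^ (k + 1) = (Qlin ^ (k + 1)).restrict _ := Module.End.pow_restrict (k + 1) mapsTo_Qlin_ker_Qplin
    rw [hpow, LinearMap.ker_restrict, Submodule.map_comap_subtype]
  rw [hmap, LinearEquiv.finrank_eq (Submodule.equivSubtypeMap _ _).symm, Module.finrank,
    Module.End.rank_ker_pow_of_surjective hf, hrank]
  have : ((k + 1 : ℕ) : Cardinal) * 2 = ((2 * k + 2 : ℕ) : Cardinal) := by push_cast; ring
  rw [this, Cardinal.toNat_natCast]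
end

section
/- For every ψ : ℤ×ℤ → ℝ with Q⁺ψ = 0, every n ∈ ℤ×ℤ, and every integer k ≥ 0, there exists a unique p ∈ 𝒫ₖ such that p(x) = ψ(x) for all x in the big black triangle T_n^{(k)}. -/
/-- The big black triangle `T_n^{(k)} = {(n₁−i, n₂−j) : i, j ≥ 0, i+j ≤ 2k+1}`. -/
def bigT (n : ℤ × ℤ) (k : ℕ) : Set (ℤ × ℤ) :=
  {x | ∃ i j : ℕ, (i : ℤ) + j ≤ 2 * k + 1 ∧ x = (n.1 - i, n.2 - j)}

theorem Qadj_sub (p q : ℤ × ℤ → ℝ) : Qadj (p - q) = Qadj p - Qadj q := by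
  funext m
  simp only [Qadj, Pi.sub_apply]
  ring

theorem Qop_sub (p q : ℤ × ℤ → ℝ) : Qop (p - q) = Qop p - Qop q := by
  funext m
  simp only [Qop, Pi.sub_apply]
  ring

theorem iterate_Qop_sub (k : ℕ) (p q : ℤ × ℤ → ℝ) :
    Qop^[k] (p - q) = Qop^[k] p - Qop^[k] q := by
  induction k generalizing p q with
  | zero => rfl
  | succ k ih => rw [Function.iterate_succ_apply, Qop_sub, ih]; rfl

theorem Qadj_Qop_eq_zero {p : ℤ × ℤ → ℝ} (hp : Qadj p = 0) : Qadj (Qop p) = 0 := by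
  funext ⟨a, b⟩
  have h₀ := congrFun hp (a, b)
  have h₁ := congrFun hp (a + 1, b)
  have h₂ := congrFun hp (a, b + 1)
  simp only [Qadj, Qop, Pi.zero_apply, add_sub_cancel_right, sub_add_cancel] at *
  linarith

/-- A function in the kernels of both `Qop` and `Qadj` that vanishes on a black triangle is zero. -/
theorem eq_zero_of_Qop_of_Qadj {p : ℤ × ℤ → ℝ} (hQ : Qop p = 0) (hp : Qadj p = 0) {a b : ℤ}
    (h₀ : p (a, b) = 0) (h₁ : p (a - 1, b) = 0) (h₂ : p (a, b - 1) = 0) : p = 0 := by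
  have hW (c d : ℤ) : p (c, d) + p (c + 1, d) + p (c, d + 1) = 0 := congrFun hQ (c, d)
  have hB (c d : ℤ) : p (c, d) + p (c - 1, d) + p (c, d - 1) = 0 := congrFun hp (c, d)
  let Z (c d : ℤ) : Prop := p (c, d) = 0 ∧ p (c - 1, d) = 0 ∧ p (c, d - 1) = 0
  have right (c d : ℤ) (h : Z c d) : Z (c + 1) d := by
    obtain ⟨h₀, h₁, h₂⟩ := h
    have e₁ := hW c (d - 1)
    have e₂ := hB (c + 1) d
    simp only [sub_add_cancel, add_sub_cancel_right] at e₁ e₂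
    simp only [Z, add_sub_cancel_right]
    refine ⟨?_, ?_, ?_⟩ <;> linarith
  have left (c d : ℤ) (h : Z c d) : Z (c - 1) d := by
    obtain ⟨h₀, h₁, h₂⟩ := h
    have e₁ := hW (c - 1) (d - 1)
    have e₂ := hB (c - 1) d
    simp only [sub_add_cancel] at e₁
    refine ⟨?_, ?_, ?_⟩ <;> linarith
  have up (c d : ℤ) (h : Z c d) : Z c (d + 1) := by
    obtain ⟨h₀, h₁, h₂⟩ := h
    have e₁ := hW (c - 1) d
    have e₂ := hB c (d + 1)
    simp only [sub_add_cancel, add_sub_cancel_right] at e₁ e₂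
    simp only [Z, add_sub_cancel_right]
    refine ⟨?_, ?_, ?_⟩ <;> linarith
  have down (c d : ℤ) (h : Z c d) : Z c (d - 1) := by
    obtain ⟨h₀, h₁, h₂⟩ := h
    have e₁ := hW (c - 1) (d - 1)
    have e₂ := hB c (d - 1)
    simp only [sub_add_cancel] at e₁
    refine ⟨?_, ?_, ?_⟩ <;> linarith
  have row (c : ℤ) : Z c b :=
    Int.inductionOn' (motive := fun c => Z c b) c a ⟨h₀, h₁, h₂⟩
      (fun c _ h => right c b h) (fun c _ h => left c b h)
  funext ⟨c, d⟩
  exact (Int.inductionOn' (motive := fun d => Z c d) d b (row c)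
    (fun d _ h => up c d h) (fun d _ h => down c d h)).1

theorem eq_zero_of_forall_mem_bigT (k : ℕ) {p : ℤ × ℤ → ℝ} (hp : Qadj p = 0)
    (hQ : Qop^[k + 1] p = 0) (n : ℤ × ℤ) (h : ∀ x ∈ bigT n k, p x = 0) : p = 0 := by
  suffices hQp : Qop p = 0 from
    eq_zero_of_Qop_of_Qadj hQp hp (a := n.1) (b := n.2)
      (h _ ⟨0, 0, by push_cast; lia, by simp⟩) (h _ ⟨1, 0, by push_cast; lia, by simp⟩)
      (h _ ⟨0, 1, by push_cast; lia, by simp⟩)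
  induction k generalizing p n with
  | zero => exact hQ
  | succ k ih =>
    have hsmall : ∀ x ∈ bigT (n.1 - 1, n.2 - 1) k, Qop p x = 0 := by
      rintro _ ⟨i, j, hij, rfl⟩
      have e₀ := h (n.1 - 1 - i, n.2 - 1 - j) ⟨i + 1, j + 1, by push_cast; lia, by
        ext <;> push_cast <;> ring⟩
      have e₁ := h (n.1 - 1 - i + 1, n.2 - 1 - j) ⟨i, j + 1, by push_cast; lia, by
        ext <;> push_cast <;> ring⟩
      have e₂ := h (n.1 - 1 - i, n.2 - 1 - j + 1) ⟨i + 1, j, by push_cast; lia, by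
        ext <;> push_cast <;> ring⟩
      simp only [Qop]
      linarith
    have hadj := Qadj_Qop_eq_zero hp
    exact eq_zero_of_Qop_of_Qadj (ih hadj hQ _ hsmall) hadj (a := n.1 - 1) (b := n.2 - 1)
      (hsmall _ ⟨0, 0, by push_cast; lia, by simp⟩) (hsmall _ ⟨1, 0, by push_cast; lia, by simp⟩)
      (hsmall _ ⟨0, 1, by push_cast; lia, by simp⟩)

/-- A discrete holomorphic function on a big black triangle is determined by its top row. -/
theorem eqOn_bigT_of_eq_on_row {p q : ℤ × ℤ → ℝ} (hp : Qadj p = 0) (hq : Qadj q = 0)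
    (n : ℤ × ℤ) (k : ℕ) (h : ∀ i : ℕ, i ≤ 2 * k + 1 → p (n.1 - i, n.2) = q (n.1 - i, n.2)) :
    ∀ x ∈ bigT n k, p x = q x := by
  rintro _ ⟨i, j, hij, rfl⟩
  induction j generalizing i with
  | zero => simpa using h i (by lia)
  | succ j ih =>
    have e₀ := ih i (by push_cast at hij; lia)
    have e₁ := ih (i + 1) (by push_cast at hij ⊢; lia)
    have hp' := congrFun hp (n.1 - i, n.2 - j)
    have hq' := congrFun hq (n.1 - i, n.2 - j)
    simp only [Qadj, Pi.zero_apply] at hp' hq'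
    push_cast at e₁ ⊢
    rw [← sub_sub] at e₁ ⊢
    linarith

/-- The discrete exponential `m ↦ φ (u ^ (n₁ - m₁) * v ^ (n₂ - m₂))`. -/
def discreteExp {A : Type*} [CommRing A] [Algebra ℝ A] (φ : A →ₗ[ℝ] ℝ) (u v : Aˣ)
    (n : ℤ × ℤ) : ℤ × ℤ → ℝ :=
  fun m => φ ((u ^ (n.1 - m.1) * v ^ (n.2 - m.2) : Aˣ) : A)

section discreteExp

variable {A : Type*} [CommRing A] [Algebra ℝ A] (φ : A →ₗ[ℝ] ℝ) (u v : Aˣ) (n : ℤ × ℤ)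

theorem Qadj_discreteExp (h : (1 + u + v : A) = 0) : Qadj (discreteExp φ u v n) = 0 := by
  funext m
  simp only [Qadj, discreteExp, Pi.zero_apply, ← map_add]
  rw [show n.1 - (m.1 - 1) = n.1 - m.1 + 1 by ring, show n.2 - (m.2 - 1) = n.2 - m.2 + 1 by ring,
    zpow_add_one, zpow_add_one]
  push_cast
  rw [← map_zero φ]
  congr 1
  linear_combination (((u ^ (n.1 - m.1) : Aˣ) : A) * ((v ^ (n.2 - m.2) : Aˣ) : A)) * h

theorem Qop_discreteExp :
    Qop (discreteExp φ u v n) =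
      discreteExp (φ ∘ₗ LinearMap.mulLeft ℝ (1 + ↑u⁻¹ + ↑v⁻¹ : A)) u v n := by
  funext m
  simp only [Qop, discreteExp, LinearMap.comp_apply, LinearMap.mulLeft_apply, ← map_add]
  rw [show n.1 - (m.1 + 1) = n.1 - m.1 - 1 by ring, show n.2 - (m.2 + 1) = n.2 - m.2 - 1 by ring,
    zpow_sub_one, zpow_sub_one]
  push_cast
  congr 1
  ring

theorem iterate_Qop_discreteExp (k : ℕ) :
    Qop^[k] (discreteExp φ u v n) =
      discreteExp (φ ∘ₗ LinearMap.mulLeft ℝ ((1 + ↑u⁻¹ + ↑v⁻¹ : A) ^ k)) u v n := by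
  induction k generalizing φ with
  | zero => simp
  | succ k ih =>
    rw [Function.iterate_succ_apply, Qop_discreteExp, ih, LinearMap.comp_assoc,
      ← LinearMap.mulLeft_mul, pow_succ']

end discreteExp

open Polynomial in
theorem exists_interpolating_on_row (f : ℕ → ℝ) (n : ℤ × ℤ) (k : ℕ) :
    ∃ p : ℤ × ℤ → ℝ, (Qadj p = 0 ∧ Qop^[k + 1] p = 0) ∧
      ∀ i : ℕ, i ≤ 2 * k + 1 → p (n.1 - i, n.2) = f i := by
  have hdeg₀ : (X ^ 2 + X + 1 : ℝ[X]).natDegree = 2 := by compute_degree!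
  have hmonic₀ : (X ^ 2 + X + 1 : ℝ[X]).Monic := by monicity!
  let g : ℝ[X] := (X ^ 2 + X + 1) ^ (k + 1)
  have hg : g.Monic := hmonic₀.pow _
  have hdeg : g.natDegree = 2 * k + 2 := by
    rw [hmonic₀.natDegree_pow, hdeg₀]
    ring
  let x : AdjoinRoot g := AdjoinRoot.root g
  have hx : (x ^ 2 + x + 1) ^ (k + 1) = 0 := by
    have h : AdjoinRoot.mk g ((X ^ 2 + X + 1) ^ (k + 1)) = 0 := AdjoinRoot.mk_self
    simpa only [map_pow, map_add, map_one, AdjoinRoot.mk_X] using h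
  have hunit : IsUnit (x * -(1 + x)) := by
    rw [show x * -(1 + x) = 1 - (x ^ 2 + x + 1) by ring]
    exact IsNilpotent.isUnit_one_sub ⟨k + 1, hx⟩
  obtain ⟨u, hu⟩ := isUnit_of_mul_isUnit_left hunit
  obtain ⟨v, hv⟩ := isUnit_of_mul_isUnit_right hunit
  let B := AdjoinRoot.powerBasis' hg
  have hdim : B.dim = 2 * k + 2 := hdeg
  let φ : AdjoinRoot g →ₗ[ℝ] ℝ := B.basis.constr ℝ fun i => f i
  have hφ (i : ℕ) (hi : i < B.dim) : φ (x ^ i) = f i := by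
    have h := B.basis.constr_basis ℝ (fun i => f i) ⟨i, hi⟩
    rwa [B.basis_eq_pow] at h
  refine ⟨discreteExp φ u v n, ⟨Qadj_discreteExp φ u v n ?_, ?_⟩, fun i hi => ?_⟩
  · rw [hu, hv]
    ring
  · have hc : (1 + ↑u⁻¹ + ↑v⁻¹ : AdjoinRoot g) =
        -(x ^ 2 + x + 1) * (↑u⁻¹ * ↑v⁻¹) := by
      have h : -(x ^ 2 + x + 1) = (u * v + v + u : AdjoinRoot g) := by
        rw [hu, hv]
        ring
      rw [h]
      linear_combination (-(v : AdjoinRoot g) * ↑v⁻¹ - ↑v⁻¹) * u.mul_inv +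
        (-1 - (↑u⁻¹ : AdjoinRoot g)) * v.mul_inv
    rw [iterate_Qop_discreteExp, hc, mul_pow, neg_pow, hx]
    funext m
    simp [discreteExp]
  · simp only [discreteExp, sub_sub_cancel, sub_self, zpow_zero, mul_one, zpow_natCast,
      Units.val_pow_eq_pow_val, hu]
    exact hφ i (by lia)

/-- Discrete Taylor interpolation: for every discrete holomorphic function `ψ`
(`Q⁺ψ = 0`), every `n` and every `k ≥ 0`, there is a unique discrete polynomial
`p ∈ 𝒫ₖ` (i.e. `Q⁺p = 0` and `Q^{k+1}p = 0`) coinciding with `ψ` on the big black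
triangle `T_n^{(k)}`. -/
theorem unique_interpolating_polynomial (ψ : ℤ × ℤ → ℝ) (hψ : Qadj ψ = 0)
    (n : ℤ × ℤ) (k : ℕ) :
    ∃! p : ℤ × ℤ → ℝ,
      (Qadj p = 0 ∧ Qop^[k + 1] p = 0) ∧ ∀ x ∈ bigT n k, p x = ψ x := by
  obtain ⟨p, ⟨hp, hpQ⟩, hrow⟩ := exists_interpolating_on_row (fun i => ψ (n.1 - i, n.2)) n k
  have hpψ := eqOn_bigT_of_eq_on_row hp hψ n k hrow
  refine ⟨p, ⟨⟨hp, hpQ⟩, hpψ⟩, ?_⟩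
  rintro q ⟨⟨hq, hqQ⟩, hqψ⟩
  refine sub_eq_zero.mp (eq_zero_of_forall_mem_bigT k ?_ ?_ n fun x hx => ?_)
  · rw [Qadj_sub, hq, hp, sub_zero]
  · rw [iterate_Qop_sub, hqQ, hpQ, sub_zero]
  · rw [Pi.sub_apply, hqψ x hx, hpψ x hx, sub_self]
end

section
/- For every n ∈ ℤ×ℤ, the restriction map from H = {ψ : ℤ×ℤ → ℝ | Q⁺ψ = 0} to the space of all real-valued functions on Y_n, sending ψ to its restriction ψ|_{Y_n}, is an ℝ-linear bijection. Equivalently: any prescription of real values on Y_n extends in exactly one way to a function ψ on ℤ×ℤ with Q⁺ψ = 0. -/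
/-- The set `Y_n`: three rays emanating from `n`,
`Y_n = {n} ∪ {(n₁−j, n₂) : j ≥ 1} ∪ {(n₁, n₂+j) : j ≥ 1} ∪ {(n₁+j, n₂−j) : j ≥ 1}`. -/
def Yset (n : ℤ × ℤ) : Set (ℤ × ℤ) :=
  {n} ∪ {p | ∃ j : ℤ, 1 ≤ j ∧ p = (n.1 - j, n.2)}
      ∪ {p | ∃ j : ℤ, 1 ≤ j ∧ p = (n.1, n.2 + j)}
      ∪ {p | ∃ j : ℤ, 1 ≤ j ∧ p = (n.1 + j, n.2 - j)}

/-- The solution on the quadrant `ℕ × ℕ` of `F (i + 1) (j + 1) + F i j + F i (j + 1) = 0`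
with boundary values `F (i + 1) 0 = f (i + 1)` and `F 0 j = h j`. -/
def quadrantSolution (f h : ℕ → ℝ) : ℕ → ℕ → ℝ
  | 0, j => h j
  | i + 1, 0 => f (i + 1)
  | i + 1, j + 1 => -quadrantSolution f h i j - quadrantSolution f h i (j + 1)

theorem quadrant_unique {F G : ℕ → ℕ → ℝ}
    (hF : ∀ i j, F (i + 1) (j + 1) + F i j + F i (j + 1) = 0)
    (hG : ∀ i j, G (i + 1) (j + 1) + G i j + G i (j + 1) = 0)
    (hrow : ∀ i, F i 0 = G i 0) (hcol : ∀ j, F 0 j = G 0 j) (i j : ℕ) : F i j = G i j := by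
  induction i generalizing j with
  | zero => exact hcol j
  | succ i ih =>
    cases j with
    | zero => exact hrow _
    | succ j => linarith [hF i j, hG i j, ih j, ih (j + 1)]

theorem quadrantSolution_zero_right {f h : ℕ → ℝ} (h₀ : f 0 = h 0) (i : ℕ) :
    quadrantSolution f h i 0 = f i := by
  cases i <;> simp [quadrantSolution, h₀]

theorem quadrantSolution_zero_left (f h : ℕ → ℝ) (j : ℕ) :
    quadrantSolution f h 0 j = h j := by
  simp [quadrantSolution]

theorem quadrantSolution_rec (f h : ℕ → ℝ) (i j : ℕ) :
    quadrantSolution f h (i + 1) (j + 1) + quadrantSolution f h i j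
      + quadrantSolution f h i (j + 1) = 0 := by
  simp only [quadrantSolution]
  ring

/-- Every lattice point lies in one of the three closed sectors cut out by `Yset n`. -/
theorem exists_sector_coordinates (n p : ℤ × ℤ) :
    ∃ i j : ℕ, p = (n.1 - i, n.2 + j) ∨ p = (n.1 + j, n.2 + i - j) ∨
      p = (n.1 + i - j, n.2 - i) := by
  obtain ⟨a, b⟩ := n
  obtain ⟨x, y⟩ := p
  simp only [Prod.mk.injEq]
  by_cases hA : x ≤ a ∧ b ≤ y
  · exact ⟨(a - x).toNat, (y - b).toNat, by omega⟩
  by_cases hB : a ≤ x ∧ a + b ≤ x + y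
  · exact ⟨(x + y - a - b).toNat, (x - a).toNat, by omega⟩
  · exact ⟨(b - y).toNat, (a + b - x - y).toNat, by omega⟩

/-- Every elementary triangle lies in one of the three closed sectors cut out by `Yset n`. -/
theorem exists_sector_triangle (n p : ℤ × ℤ) :
    ∃ i j : ℕ, p = (n.1 - i, n.2 + (j + 1)) ∨ p = (n.1 + (j + 1), n.2 + i - j) ∨
      p = (n.1 + i - j, n.2 - i) := by
  obtain ⟨a, b⟩ := n
  obtain ⟨x, y⟩ := p
  simp only [Prod.mk.injEq]
  by_cases hA : x ≤ a ∧ b + 1 ≤ y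
  · exact ⟨(a - x).toNat, (y - b - 1).toNat, by omega⟩
  by_cases hB : a + 1 ≤ x ∧ a + b + 1 ≤ x + y
  · exact ⟨(x + y - a - b - 1).toNat, (x - a - 1).toNat, by omega⟩
  · exact ⟨(b - y).toNat, (a + b - x - y).toNat, by omega⟩

theorem mem_Yset_left (n : ℤ × ℤ) (j : ℕ) : (n.1 - j, n.2) ∈ Yset n := by
  rcases j.eq_zero_or_pos with rfl | hj
  · simp [Yset]
  · exact .inl (.inl (.inr ⟨j, by omega, rfl⟩))

theorem mem_Yset_up (n : ℤ × ℤ) (j : ℕ) : (n.1, n.2 + j) ∈ Yset n := by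
  rcases j.eq_zero_or_pos with rfl | hj
  · simp [Yset]
  · exact .inl (.inr ⟨j, by omega, rfl⟩)

theorem mem_Yset_diag (n : ℤ × ℤ) (j : ℕ) : (n.1 + j, n.2 - j) ∈ Yset n := by
  rcases j.eq_zero_or_pos with rfl | hj
  · simp [Yset]
  · exact .inr ⟨j, by omega, rfl⟩

theorem exists_of_mem_Yset {n p : ℤ × ℤ} (hp : p ∈ Yset n) :
    ∃ j : ℕ, p = (n.1 - j, n.2) ∨ p = (n.1, n.2 + j) ∨ p = (n.1 + j, n.2 - j) := by
  rcases hp with ((rfl | ⟨j, hj, rfl⟩) | ⟨j, hj, rfl⟩) | ⟨j, hj, rfl⟩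
  · exact ⟨0, by simp⟩
  all_goals
    lift j to ℕ using by omega
    exact ⟨j, by simp⟩

theorem Qadj_eq_zero_apply {ψ : ℤ × ℤ → ℝ} (hψ : Qadj ψ = 0) (x y : ℤ) :
    ψ (x, y) + ψ (x - 1, y) + ψ (x, y - 1) = 0 :=
  congrFun hψ (x, y)

theorem eq_of_eqOn_Yset {n : ℤ × ℤ} {φ ψ : ℤ × ℤ → ℝ} (hφ : Qadj φ = 0) (hψ : Qadj ψ = 0)
    (h : Set.EqOn φ ψ (Yset n)) : φ = ψ := by
  have left (j : ℕ) := h (mem_Yset_left n j)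
  have up (j : ℕ) := h (mem_Yset_up n j)
  have diag (j : ℕ) := h (mem_Yset_diag n j)
  have recA {χ : ℤ × ℤ → ℝ} (hχ : Qadj χ = 0) (i j : ℕ) :
      χ (n.1 - (i + 1 : ℕ), n.2 + (j + 1 : ℕ)) + χ (n.1 - i, n.2 + j)
        + χ (n.1 - i, n.2 + (j + 1 : ℕ)) = 0 := by
    have := Qadj_eq_zero_apply hχ (n.1 - i) (n.2 + (j + 1))
    push_cast
    ring_nf at this ⊢
    linarith
  have recB {χ : ℤ × ℤ → ℝ} (hχ : Qadj χ = 0) (i j : ℕ) :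
      χ (n.1 + (j + 1 : ℕ), n.2 + (i + 1 : ℕ) - (j + 1 : ℕ)) + χ (n.1 + j, n.2 + i - j)
        + χ (n.1 + (j + 1 : ℕ), n.2 + i - (j + 1 : ℕ)) = 0 := by
    have := Qadj_eq_zero_apply hχ (n.1 + (j + 1)) (n.2 + i - j)
    push_cast
    ring_nf at this ⊢
    linarith
  have recC {χ : ℤ × ℤ → ℝ} (hχ : Qadj χ = 0) (i j : ℕ) :
      χ (n.1 + (i + 1 : ℕ) - (j + 1 : ℕ), n.2 - (i + 1 : ℕ)) + χ (n.1 + i - j, n.2 - i)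
        + χ (n.1 + i - (j + 1 : ℕ), n.2 - i) = 0 := by
    have := Qadj_eq_zero_apply hχ (n.1 + i - j) (n.2 - i)
    push_cast
    ring_nf at this ⊢
    linarith
  funext p
  obtain ⟨i, j, rfl | rfl | rfl⟩ := exists_sector_coordinates n p
  · exact quadrant_unique (F := fun i j => φ (n.1 - i, n.2 + j))
      (G := fun i j => ψ (n.1 - i, n.2 + j)) (recA hφ) (recA hψ)
      (fun i => by simpa using left i) (fun j => by simpa using up j) i j
  · exact quadrant_unique (F := fun i j => φ (n.1 + j, n.2 + i - j))
      (G := fun i j => ψ (n.1 + j, n.2 + i - j)) (recB hφ) (recB hψ)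
      (fun i => by simpa using up i) (fun j => by simpa using diag j) i j
  · exact quadrant_unique (F := fun i j => φ (n.1 + i - j, n.2 - i))
      (G := fun i j => ψ (n.1 + i - j, n.2 - i)) (recC hφ) (recC hψ)
      (fun i => by simpa using diag i) (fun j => by simpa using left j) i j

/-- Solutions on three quadrants that agree along their common boundary rays glue to a
function on the lattice. -/
theorem exists_glue_sectors (n : ℤ × ℤ) {A B C : ℕ → ℕ → ℝ} (hAB : ∀ j, A 0 j = B j 0)
    (hBC : ∀ j, B 0 j = C j 0) (hCA : ∀ j, C 0 j = A j 0) :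
    ∃ ψ : ℤ × ℤ → ℝ, ∀ i j : ℕ, ψ (n.1 - i, n.2 + j) = A i j ∧
      ψ (n.1 + j, n.2 + i - j) = B i j ∧ ψ (n.1 + i - j, n.2 - i) = C i j := by
  refine ⟨fun p =>
    if p.1 ≤ n.1 ∧ n.2 ≤ p.2 then A (n.1 - p.1).toNat (p.2 - n.2).toNat
    else if n.1 ≤ p.1 ∧ n.1 + n.2 ≤ p.1 + p.2 then
      B (p.1 + p.2 - n.1 - n.2).toNat (p.1 - n.1).toNat
    else C (n.2 - p.2).toNat (n.1 + n.2 - p.1 - p.2).toNat, fun i j => ⟨?_, ?_, ?_⟩⟩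
  · dsimp only
    rw [if_pos (by constructor <;> omega)]
    congr 1 <;> simp
  · dsimp only
    split_ifs with h₁ h₂
    · obtain rfl : j = 0 := by omega
      simp [hAB]
    · congr 1 <;> omega
    · omega
  · dsimp only
    split_ifs with h₁ h₂
    · obtain rfl : i = 0 := by omega
      simp [hCA]
    · obtain rfl : j = 0 := by omega
      simp [hBC]
    · congr 1 <;> omega

theorem exists_Qadj_eq_zero_eqOn_Yset (n : ℤ × ℤ) (G : ℤ × ℤ → ℝ) :
    ∃ ψ : ℤ × ℤ → ℝ, Qadj ψ = 0 ∧ Set.EqOn ψ G (Yset n) := by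
  let L : ℕ → ℝ := fun j => G (n.1 - j, n.2)
  let U : ℕ → ℝ := fun j => G (n.1, n.2 + j)
  let D : ℕ → ℝ := fun j => G (n.1 + j, n.2 - j)
  have hLU : L 0 = U 0 := by simp [L, U]
  have hUD : U 0 = D 0 := by simp [U, D]
  have hDL : D 0 = L 0 := by simp [D, L]
  obtain ⟨ψ, hψ⟩ := exists_glue_sectors n
    (A := quadrantSolution L U) (B := quadrantSolution U D) (C := quadrantSolution D L)
    (fun j => by rw [quadrantSolution_zero_left, quadrantSolution_zero_right hUD])
    (fun j => by rw [quadrantSolution_zero_left, quadrantSolution_zero_right hDL])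
    (fun j => by rw [quadrantSolution_zero_left, quadrantSolution_zero_right hLU])
  refine ⟨ψ, ?_, fun p hp => ?_⟩
  · funext p
    obtain ⟨i, j, rfl | rfl | rfl⟩ := exists_sector_triangle n p
    · have h := quadrantSolution_rec L U i j
      rw [← (hψ _ _).1, ← (hψ _ _).1, ← (hψ _ _).1] at h
      simp only [Qadj, Pi.zero_apply]
      push_cast at h
      ring_nf at h ⊢
      linarith
    · have h := quadrantSolution_rec U D i j
      rw [← (hψ _ _).2.1, ← (hψ _ _).2.1, ← (hψ _ _).2.1] at h
      simp only [Qadj, Pi.zero_apply]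
      push_cast at h
      ring_nf at h ⊢
      linarith
    · have h := quadrantSolution_rec D L i j
      rw [← (hψ _ _).2.2, ← (hψ _ _).2.2, ← (hψ _ _).2.2] at h
      simp only [Qadj, Pi.zero_apply]
      push_cast at h
      ring_nf at h ⊢
      linarith
  · obtain ⟨j, rfl | rfl | rfl⟩ := exists_of_mem_Yset hp
    · simpa [quadrantSolution_zero_right hLU] using (hψ j 0).1
    · simpa [quadrantSolution_zero_left] using (hψ 0 j).1
    · simpa [quadrantSolution_zero_left] using (hψ 0 j).2.1

/-- Any prescription of real values on `Y_n` extends in exactly one way to a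
discrete holomorphic function `ψ` (`Q⁺ψ = 0`); i.e. the restriction map
`H → (Y_n → ℝ)` is a bijection. -/
theorem restriction_to_Y_bijective (n : ℤ × ℤ) (g : Yset n → ℝ) :
    ∃! ψ : ℤ × ℤ → ℝ, Qadj ψ = 0 ∧ ∀ y : Yset n, ψ y = g y := by
  classical
  obtain ⟨ψ, hψ, hY⟩ :=
    exists_Qadj_eq_zero_eqOn_Yset n (fun p => if hp : p ∈ Yset n then g ⟨p, hp⟩ else 0)
  have hψg (y : Yset n) : ψ y = g y := by simpa using hY y.2
  refine ⟨ψ, ⟨hψ, hψg⟩, fun φ hφ => eq_of_eqOn_Yset (n := n) hφ.1 hψ fun p hp => ?_⟩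
  exact (hφ.2 ⟨p, hp⟩).trans (hψg ⟨p, hp⟩).symm
end

section
/- Discrete Cauchy formula: let D ⊆ ℤ×ℤ be a finite set, and let ψ : ℤ×ℤ → ℝ vanish outside D and satisfy (Q⁺ψ)(m) = 0 for every m whose black triangle B(m) = {m, m−(1,0), m−(0,1)} is contained in D. Let ∂₊D = {m ∈ ℤ×ℤ : B(m) ⊄ D and B(m) ∩ D ≠ ∅} (a finite set). Then for every n ∈ D one has ψ(n) = Σ_{m ∈ ∂₊D} (Q⁺ψ)(m) · G(n−m), where n−m is componentwise subtraction. -/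
/-- The black triangle indexed by `m`: the three-point set `{m, m−(1,0), m−(0,1)}`. -/
def Btri (m : ℤ × ℤ) : Set (ℤ × ℤ) :=
  {m, (m.1 - 1, m.2), (m.1, m.2 - 1)}

/-- The Pascal-triangle function `G(n₁,n₂) = (−1)^{n₁+n₂} · C(n₁+n₂, n₁)` for
`n₁, n₂ ≥ 0`, and `G = 0` otherwise. -/
noncomputable def G (n : ℤ × ℤ) : ℝ :=
  if 0 ≤ n.1 ∧ 0 ≤ n.2 then
    (-1 : ℝ) ^ (n.1 + n.2) * (Nat.choose (n.1 + n.2).toNat n.1.toNat : ℝ)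
  else 0

theorem G_natCast (a b : ℕ) :
    G ((a : ℤ), (b : ℤ)) = (-1 : ℝ) ^ (a + b) * ((a + b).choose a : ℝ) := by
  have h : ((a : ℤ) + b).toNat = a + b := by omega
  simp only [G, Int.natCast_nonneg, and_self, if_true, h, Int.toNat_natCast]
  rw [← Nat.cast_add, zpow_natCast]

theorem G_of_fst_neg {a : ℤ} (ha : a < 0) (b : ℤ) : G (a, b) = 0 :=
  if_neg fun h => absurd h.1 (not_le.mpr ha)

theorem G_of_snd_neg (a : ℤ) {b : ℤ} (hb : b < 0) : G (a, b) = 0 :=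
  if_neg fun h => absurd h.2 (not_le.mpr hb)

/-- `G` is a fundamental solution of `Q⁺`. -/
theorem Qadj_G (n : ℤ × ℤ) : Qadj G n = if n = 0 then 1 else 0 := by
  obtain ⟨a, b⟩ := n
  simp only [Qadj, Prod.mk_eq_zero]
  rcases lt_or_ge a 0 with ha | ha
  · rw [G_of_fst_neg ha, G_of_fst_neg (by omega), G_of_fst_neg ha, if_neg (by omega)]
    norm_num
  rcases lt_or_ge b 0 with hb | hb
  · rw [G_of_snd_neg _ hb, G_of_snd_neg _ hb, G_of_snd_neg _ (by omega), if_neg (by omega)]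
    norm_num
  lift a to ℕ using ha
  lift b to ℕ using hb
  have hsub (k : ℕ) : ((k + 1 : ℕ) : ℤ) - 1 = k := by omega
  rcases a with _ | a <;> rcases b with _ | b
  · rw [G_natCast, G_of_fst_neg (by norm_num), G_of_snd_neg _ (by norm_num)]
    norm_num
  · rw [hsub, G_natCast, G_of_fst_neg (by norm_num), G_natCast, if_neg (by omega)]
    simp [pow_succ]
  · rw [hsub, G_natCast, G_natCast, G_of_snd_neg _ (by norm_num), if_neg (by omega)]
    simp [pow_succ]
  · rw [hsub, hsub, G_natCast, G_natCast, G_natCast, if_neg (by omega),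
      show a + 1 + (b + 1) = (a + b + 1) + 1 by ring, show a + (b + 1) = a + b + 1 by ring,
      show a + 1 + b = a + b + 1 by ring, Nat.choose_succ_succ]
    push_cast
    ring

/-- Convolving `Q⁺ψ` with `G` recovers a finitely supported `ψ`. -/
theorem finsum_Qadj_mul_G {ψ : ℤ × ℤ → ℝ} (hψ : ψ.support.Finite) (n : ℤ × ℤ) :
    ∑ᶠ m, Qadj ψ m * G (n - m) = ψ n := by
  have hfin (g : ℤ × ℤ → ℝ) : (Function.support fun m => ψ m * g m).Finite :=
    hψ.subset (Function.support_mul_subset_left _ _)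
  have hfin_shift (v : ℤ × ℤ) (g : ℤ × ℤ → ℝ) :
      (Function.support fun m => ψ (m - v) * g m).Finite :=
    (hψ.preimage (sub_left_injective (b := v)).injOn).subset
      (Function.support_mul_subset_left _ _)
  have hshift (v : ℤ × ℤ) :
      ∑ᶠ m, ψ (m - v) * G (n - m) = ∑ᶠ m, ψ m * G (n - m - v) := by
    rw [← finsum_comp_equiv (Equiv.subRight v) (f := fun m => ψ m * G (n - m - v))]
    refine finsum_congr fun m => ?_
    simp only [Equiv.subRight_apply]
    congr 2
    abel
  have hQ (φ : ℤ × ℤ → ℝ) (m : ℤ × ℤ) : Qadj φ m = φ m + φ (m - (1, 0)) + φ (m - (0, 1)) := by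
    simp [Qadj, Prod.sub_def]
  calc ∑ᶠ m, Qadj ψ m * G (n - m)
      = ∑ᶠ m, ((ψ m * G (n - m) + ψ (m - (1, 0)) * G (n - m))
          + ψ (m - (0, 1)) * G (n - m)) :=
        finsum_congr fun m => by rw [hQ]; ring
    _ = ∑ᶠ m, ψ m * G (n - m) + ∑ᶠ m, ψ m * G (n - m - (1, 0))
          + ∑ᶠ m, ψ m * G (n - m - (0, 1)) := by
        rw [finsum_add_distrib
          (((hfin _).union (hfin_shift _ _)).subset (Function.support_add _ _))
          (hfin_shift _ _), finsum_add_distrib (hfin _) (hfin_shift _ _), hshift, hshift]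
    _ = ∑ᶠ m, ψ m * Qadj G (n - m) := by
        rw [← finsum_add_distrib (hfin _) (hfin _), ← finsum_add_distrib
          (((hfin _).union (hfin _)).subset (Function.support_add _ _)) (hfin _)]
        exact finsum_congr fun m => by rw [hQ]; ring
    _ = ψ n := by
        rw [finsum_eq_single _ n fun m hm => by
          rw [Qadj_G, if_neg (sub_ne_zero.mpr hm.symm), mul_zero]]
        simp [Qadj_G]

/-- `(Q⁺ψ)(m)` vanishes when `ψ` is zero on the black triangle `B(m)`. -/
theorem Qadj_eq_zero {ψ : ℤ × ℤ → ℝ} {m : ℤ × ℤ} (h : ∀ k ∈ Btri m, ψ k = 0) :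
    Qadj ψ m = 0 := by
  simp [Qadj, h m (by simp [Btri]), h (m.1 - 1, m.2) (by simp [Btri]),
    h (m.1, m.2 - 1) (by simp [Btri])]

/-- Discrete Cauchy formula: a function `ψ` vanishing outside a finite domain `D`
and discretely holomorphic on `D` (i.e. `(Q⁺ψ)(m) = 0` whenever the black triangle
`B(m)` lies in `D`) is recovered inside `D` from its "boundary data" by
`ψ(n) = Σ_{m ∈ ∂₊D} (Q⁺ψ)(m) · G(n−m)`. -/
theorem discrete_cauchy_formula (D : Finset (ℤ × ℤ)) (ψ : ℤ × ℤ → ℝ)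
    (hout : ∀ n, n ∉ D → ψ n = 0)
    (hhol : ∀ m : ℤ × ℤ, Btri m ⊆ ↑D → Qadj ψ m = 0)
    (n : ℤ × ℤ) (hn : n ∈ D) :
    ψ n = ∑ᶠ m ∈ {m : ℤ × ℤ | ¬ Btri m ⊆ ↑D ∧ (Btri m ∩ ↑D).Nonempty},
      Qadj ψ m * G (n - m) := by
  classical
  rw [← finsum_Qadj_mul_G (D.finite_toSet.subset fun m hm =>
    by_contra fun h => hm (hout m h)) n]
  refine finsum_congr fun m => ?_
  by_cases hm : m ∈ {m : ℤ × ℤ | ¬ Btri m ⊆ ↑D ∧ (Btri m ∩ ↑D).Nonempty}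
  · rw [finsum_eq_if, if_pos hm]
  · have hzero : Qadj ψ m = 0 := by
      by_cases hB : Btri m ⊆ ↑D
      · exact hhol m hB
      · exact Qadj_eq_zero fun k hk => hout k fun hkD => hm ⟨hB, k, hk, hkD⟩
    rw [finsum_eq_if, if_neg hm, hzero, zero_mul]
end

section
/- The discrete Cauchy formula holds with an arbitrary fundamental solution: let Γ : ℤ×ℤ → ℝ satisfy (Q⁺Γ)(0,0) = 1 and (Q⁺Γ)(n) = 0 for all n ≠ (0,0). Let D ⊆ ℤ×ℤ be finite, and let ψ : ℤ×ℤ → ℝ vanish outside D and satisfy (Q⁺ψ)(m) = 0 for every m with B(m) ⊆ D. Then for every n ∈ D, ψ(n) = Σ_{m ∈ ∂₊D} (Q⁺ψ)(m) · Γ(n−m), where ∂₊D = {m : B(m) ⊄ D and B(m) ∩ D ≠ ∅}. -/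
/-- `Q⁺` commutes with convolution: the translates of `Q⁺` may be moved from a finitely
supported function to the other factor. -/
theorem finsum_Qadj_mul_sub (Γ ψ : ℤ × ℤ → ℝ) (hψ : ψ.support.Finite) (n : ℤ × ℤ) :
    ∑ᶠ m, Qadj ψ m * Γ (n - m) = ∑ᶠ k, ψ k * Qadj Γ (n - k) := by
  have hfin (a : ℤ × ℤ) (g : ℤ × ℤ → ℝ) :
      (Function.support fun m => ψ (m - a) * g m).Finite := by
    refine (hψ.preimage (sub_left_injective (b := a)).injOn).subset fun m hm => ?_
    exact left_ne_zero_of_mul hm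
  have hshift (a : ℤ × ℤ) :
      ∑ᶠ m, ψ (m - a) * Γ (n - m) = ∑ᶠ k, ψ (k - 0) * Γ (n - k - a) := by
    rw [← finsum_comp_equiv (Equiv.addRight a)]
    refine finsum_congr fun k => ?_
    simp [sub_sub]
  have hQ (φ : ℤ × ℤ → ℝ) (m : ℤ × ℤ) :
      Qadj φ m = φ (m - 0) + φ (m - (1, 0)) + φ (m - (0, 1)) := by
    simp [Qadj, Prod.sub_def]
  have hadd (u v w : ℤ × ℤ → ℝ) (hu : u.support.Finite) (hv : v.support.Finite)
      (hw : w.support.Finite) :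
      ∑ᶠ m, (u m + v m + w m) = ∑ᶠ m, u m + ∑ᶠ m, v m + ∑ᶠ m, w m := by
    rw [← finsum_add_distrib hu hv, ← finsum_add_distrib _ hw]
    exact (hu.union hv).subset (Function.support_add u v)
  calc ∑ᶠ m, Qadj ψ m * Γ (n - m)
      = ∑ᶠ m, (ψ (m - 0) * Γ (n - m) + ψ (m - (1, 0)) * Γ (n - m)
          + ψ (m - (0, 1)) * Γ (n - m)) :=
        finsum_congr fun m => by rw [hQ]; ring
    _ = ∑ᶠ k, (ψ (k - 0) * Γ (n - k - 0) + ψ (k - 0) * Γ (n - k - (1, 0))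
          + ψ (k - 0) * Γ (n - k - (0, 1))) := by
        rw [hadd _ _ _ (hfin _ _) (hfin _ _) (hfin _ _),
          hadd _ _ _ (hfin _ _) (hfin _ _) (hfin _ _), hshift 0, hshift (1, 0), hshift (0, 1)]
    _ = ∑ᶠ k, ψ k * Qadj Γ (n - k) :=
        finsum_congr fun k => by rw [hQ, sub_zero k]; ring

/-- `Q⁺ψ` vanishes at `m` when the triangle `B(m)` misses a set outside of which `ψ` vanishes. -/
theorem Qadj_eq_zero_of_disjoint {D : Set (ℤ × ℤ)} {ψ : ℤ × ℤ → ℝ}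
    (hout : ∀ n, n ∉ D → ψ n = 0) {m : ℤ × ℤ} (hm : Disjoint (Btri m) D) : Qadj ψ m = 0 := by
  have h : ∀ k ∈ Btri m, ψ k = 0 := fun k hk => hout k (Set.disjoint_left.mp hm hk)
  simp [Qadj, h m (by simp [Btri]), h (m.1 - 1, m.2) (by simp [Btri]),
    h (m.1, m.2 - 1) (by simp [Btri])]

/-- The discrete Cauchy formula holds with an arbitrary fundamental solution `Γ`
of the black-triangle equation (`Q⁺Γ = δ`): if `ψ` vanishes outside a finite set
`D` and `(Q⁺ψ)(m) = 0` whenever `B(m) ⊆ D`, then for `n ∈ D`,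
`ψ(n) = Σ_{m ∈ ∂₊D} (Q⁺ψ)(m) · Γ(n−m)`. -/
theorem discrete_cauchy_formula_general (Γ : ℤ × ℤ → ℝ)
    (hΓ : ∀ n : ℤ × ℤ, Qadj Γ n = if n = (0, 0) then 1 else 0)
    (D : Finset (ℤ × ℤ)) (ψ : ℤ × ℤ → ℝ)
    (hout : ∀ n, n ∉ D → ψ n = 0)
    (hhol : ∀ m : ℤ × ℤ, Btri m ⊆ ↑D → Qadj ψ m = 0)
    (n : ℤ × ℤ) (hn : n ∈ D) :
    ψ n = ∑ᶠ m ∈ {m : ℤ × ℤ | ¬ Btri m ⊆ ↑D ∧ (Btri m ∩ ↑D).Nonempty},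
      Qadj ψ m * Γ (n - m) := by
  have hψ : ψ.support.Finite :=
    D.finite_toSet.subset fun k hk => by_contra fun hkD => hk (hout k hkD)
  have hsupp : (Function.support fun m => Qadj ψ m * Γ (n - m)) ⊆
      {m : ℤ × ℤ | ¬ Btri m ⊆ ↑D ∧ (Btri m ∩ ↑D).Nonempty} := by
    intro m hm
    have hQ : Qadj ψ m ≠ 0 := left_ne_zero_of_mul hm
    refine ⟨fun h => hQ (hhol m h), Set.not_disjoint_iff_nonempty_inter.mp fun h => hQ ?_⟩
    exact Qadj_eq_zero_of_disjoint (by simpa using hout) h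
  rw [← finsum_mem_inter_support, Set.inter_eq_right.mpr hsupp, finsum_mem_support,
    finsum_Qadj_mul_sub Γ ψ hψ n, finsum_eq_single _ n]
  · rw [hΓ, sub_self, Prod.mk_zero_zero, if_pos rfl, mul_one]
  · intro k hk
    rw [hΓ, Prod.mk_zero_zero, if_neg fun h => hk (sub_eq_zero.mp h).symm, mul_zero]
end

section
/- Maximum principle on the triangular lattice: let K ⊆ ℤ×ℤ be a finite set (indexing black triangles) and let ψ : ℤ×ℤ → ℝ satisfy (Q⁺ψ)(m) = 0 for every m ∈ K. Call m ∈ K internal if all six neighbors m+(1,0), m−(1,0), m+(0,1), m−(0,1), m+(1,−1), m+(−1,1) belong to K. Then the image v_ψ(K) ⊆ ℝ² is contained in the convex hull of v_ψ(K \ I), where I ⊆ K is the set of internal elements. -/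
/-- The unique point of the black triangle `B(m) = {m, m−(1,0), m−(0,1)}` whose
color `(p₁ − p₂) mod 3` equals `i`. -/
def pickColor (m : ℤ × ℤ) (i : ℤ) : ℤ × ℤ :=
  if (m.1 - m.2) % 3 = i then m
  else if (m.1 - 1 - m.2) % 3 = i then (m.1 - 1, m.2)
  else (m.1, m.2 - 1)

/-- `v_ψ(m) = (ψ(x₀), ψ(x₁)) ∈ ℝ²`, where `xᵢ` is the point of `B(m)` of color `i`. -/
def vpt (ψ : ℤ × ℤ → ℝ) (m : ℤ × ℤ) : ℝ × ℝ :=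
  (ψ (pickColor m 0), ψ (pickColor m 1))

/-- An element `m ∈ K` is internal if all six neighbors of `m` belong to `K`. -/
def internal (K : Finset (ℤ × ℤ)) (m : ℤ × ℤ) : Prop :=
  (m.1 + 1, m.2) ∈ K ∧ (m.1 - 1, m.2) ∈ K ∧ (m.1, m.2 + 1) ∈ K ∧
    (m.1, m.2 - 1) ∈ K ∧ (m.1 + 1, m.2 - 1) ∈ K ∧ (m.1 - 1, m.2 + 1) ∈ K

/-- The sum of `ψ` over the black triangle `B(m)`, where a point of color `i` has weight `w i`. -/
def weightedSum (w : ℤ → ℝ) (ψ : ℤ × ℤ → ℝ) (m : ℤ × ℤ) : ℝ :=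
  w (m.1 - m.2) * ψ m + w (m.1 - m.2 - 1) * ψ (m.1 - 1, m.2) +
    w (m.1 - m.2 + 1) * ψ (m.1, m.2 - 1)

/-- The weight of color `i` lies strictly between the weights of the two other colors. -/
def IsMiddle (w : ℤ → ℝ) (i : ℤ) : Prop :=
  (w i - w (i + 1)) * (w i - w (i - 1)) < 0

theorem eq_zero_of_mul_nonpos {x y t : ℝ} (hxy : x * y < 0) (hx : x * t ≤ 0) (hy : y * t ≤ 0) :
    t = 0 := by
  by_contra ht
  have h : 0 < t * t := mul_self_pos.mpr ht
  nlinarith [mul_nonneg_of_nonpos_of_nonpos hx hy, mul_neg_of_neg_of_pos hxy h]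

section Propagation

variable {w : ℤ → ℝ} {ψ : ℤ × ℤ → ℝ}

theorem IsMiddle.of_emod_eq (hw : Function.Periodic w 3) {i j : ℤ} (h : IsMiddle w i)
    (hij : i % 3 = j % 3) : IsMiddle w j := by
  obtain ⟨k, rfl⟩ : ∃ k, j = i + k * 3 := ⟨(j - i) / 3, by omega⟩
  have hk : Function.Periodic w (k * 3) := by simpa using hw.int_mul k
  simp only [IsMiddle] at h ⊢
  rwa [show i + k * 3 + 1 = i + 1 + k * 3 by ring, show i + k * 3 - 1 = i - 1 + k * 3 by ring,
    hk, hk, hk]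

theorem weightedSum_add_fst_eq (hw : Function.Periodic w 3) {a b : ℤ}
    (hmid : IsMiddle w (a - b - 1)) (h₀ : Qadj ψ (a, b) = 0) (h₁ : Qadj ψ (a + 1, b) = 0)
    (h₂ : Qadj ψ (a + 1, b - 1) = 0)
    (hle₁ : weightedSum w ψ (a + 1, b) ≤ weightedSum w ψ (a, b))
    (hle₂ : weightedSum w ψ (a + 1, b - 1) ≤ weightedSum w ψ (a, b)) :
    weightedSum w ψ (a + 1, b) = weightedSum w ψ (a, b) := by
  have e₁ : w (a - b + 2) = w (a - b - 1) := by
    rw [← hw (a - b - 1)]; congr 1; ring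
  have e₂ : w (a - b - 2) = w (a - b + 1) := by
    rw [← hw (a - b - 2)]; congr 1; ring
  have e₃ : w (a - b + 3) = w (a - b) := hw _
  simp only [weightedSum, Qadj, IsMiddle, add_sub_cancel_right, sub_add_cancel,
    show a + 1 - b = a - b + 1 by ring, show a - b + 1 + 1 = a - b + 2 by ring,
    show a + 1 - (b - 1) = a - b + 2 by ring, show a - b + 2 - 1 = a - b + 1 by ring,
    show a - b + 2 + 1 = a - b + 3 by ring, show a - b - 1 - 1 = a - b - 2 by ring,
    e₁, e₂, e₃] at hmid h₀ h₁ h₂ hle₁ hle₂ ⊢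
  have key := eq_zero_of_mul_nonpos (t := ψ (a + 1, b - 1) - ψ (a - 1, b)) hmid
    (by linear_combination hle₂ - w (a - b) * (h₂ - h₀))
    (by linear_combination hle₁ - w (a - b + 1) * (h₁ - h₀))
  linear_combination (w (a - b - 1) - w (a - b + 1)) * key + w (a - b + 1) * (h₁ - h₀)

theorem weightedSum_sub_fst_eq (hw : Function.Periodic w 3) {a b : ℤ}
    (hmid : IsMiddle w (a - b)) (h₀ : Qadj ψ (a, b) = 0) (h₁ : Qadj ψ (a - 1, b) = 0)
    (h₂ : Qadj ψ (a, b - 1) = 0)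
    (hle₁ : weightedSum w ψ (a - 1, b) ≤ weightedSum w ψ (a, b))
    (hle₂ : weightedSum w ψ (a, b - 1) ≤ weightedSum w ψ (a, b)) :
    weightedSum w ψ (a - 1, b) = weightedSum w ψ (a, b) := by
  have e₁ : w (a - b + 2) = w (a - b - 1) := by
    rw [← hw (a - b - 1)]; congr 1; ring
  have e₂ : w (a - b - 2) = w (a - b + 1) := by
    rw [← hw (a - b - 2)]; congr 1; ring
  simp only [weightedSum, Qadj, IsMiddle, add_sub_cancel_right, sub_add_cancel,
    show a - 1 - b = a - b - 1 by ring, show a - (b - 1) = a - b + 1 by ring,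
    show a - b + 1 + 1 = a - b + 2 by ring, show a - b - 1 - 1 = a - b - 2 by ring,
    e₁, e₂] at hmid h₀ h₁ h₂ hle₁ hle₂ ⊢
  have key := eq_zero_of_mul_nonpos (t := ψ (a - 1, b - 1) - ψ (a, b)) hmid
    (by linear_combination hle₁ - w (a - b + 1) * (h₁ - h₀))
    (by linear_combination hle₂ - w (a - b - 1) * (h₂ - h₀))
  linear_combination (w (a - b) - w (a - b + 1)) * key + w (a - b + 1) * (h₁ - h₀)

theorem Qadj_comp_swap (m : ℤ × ℤ) : Qadj (ψ ∘ Prod.swap) m = Qadj ψ m.swap := by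
  simp only [Qadj, Function.comp_apply, Prod.swap]
  ring

theorem weightedSum_comp_swap (m : ℤ × ℤ) :
    weightedSum (fun i => w (-i)) (ψ ∘ Prod.swap) m = weightedSum w ψ m.swap := by
  obtain ⟨a, b⟩ := m
  simp only [weightedSum, Function.comp_apply, Prod.swap_prod_mk,
    show -(a - b) = b - a by ring, show -(a - b - 1) = b - a + 1 by ring,
    show -(a - b + 1) = b - a - 1 by ring]
  ring

theorem weightedSum_add_snd_eq (hw : Function.Periodic w 3) {a b : ℤ}
    (hmid : IsMiddle w (a - b + 1)) (h₀ : Qadj ψ (a, b) = 0) (h₁ : Qadj ψ (a, b + 1) = 0)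
    (h₂ : Qadj ψ (a - 1, b + 1) = 0)
    (hle₁ : weightedSum w ψ (a, b + 1) ≤ weightedSum w ψ (a, b))
    (hle₂ : weightedSum w ψ (a - 1, b + 1) ≤ weightedSum w ψ (a, b)) :
    weightedSum w ψ (a, b + 1) = weightedSum w ψ (a, b) := by
  have hmid' : IsMiddle (fun i => w (-i)) (b - a - 1) := by
    simp only [IsMiddle, show -(b - a - 1) = a - b + 1 by ring,
      show -(b - a - 1 + 1) = a - b + 1 - 1 by ring,
      show -(b - a - 1 - 1) = a - b + 1 + 1 by ring] at hmid ⊢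
    rwa [mul_comm]
  have hw' : Function.Periodic (fun i => w (-i)) 3 := fun i => by
    simpa only [neg_add, neg_add_cancel_right] using (hw (-i + -3)).symm
  simpa only [weightedSum_comp_swap, Prod.swap_prod_mk] using
    weightedSum_add_fst_eq (ψ := ψ ∘ Prod.swap) hw' hmid'
      (by simpa only [Qadj_comp_swap, Prod.swap_prod_mk] using h₀) (by simpa only [Qadj_comp_swap, Prod.swap_prod_mk] using h₁)
      (by simpa only [Qadj_comp_swap, Prod.swap_prod_mk] using h₂)
      (by simpa only [weightedSum_comp_swap, Prod.swap_prod_mk] using hle₁)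
      (by simpa only [weightedSum_comp_swap, Prod.swap_prod_mk] using hle₂)

/-- A weighted sum with pairwise distinct weights attains its maximum at a non-internal triangle. -/
theorem exists_not_internal_forall_weightedSum_le (hw : Function.Periodic w 3) {i : ℤ}
    (hi : IsMiddle w i) {K : Finset (ℤ × ℤ)} (hK : K.Nonempty) (hψ : ∀ m ∈ K, Qadj ψ m = 0) :
    ∃ m ∈ K, ¬ internal K m ∧ ∀ m' ∈ K, weightedSum w ψ m' ≤ weightedSum w ψ m := by
  classical
  by_contra! hcon
  have hint : ∀ m ∈ K, (∀ m' ∈ K, weightedSum w ψ m' ≤ weightedSum w ψ m) → internal K m := by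
    intro m hm hmax
    by_contra h
    obtain ⟨m', hm', hlt⟩ := hcon m hm h
    exact absurd (hmax m' hm') (not_le.mpr hlt)
  set T := K.filter fun m => (∀ m' ∈ K, weightedSum w ψ m' ≤ weightedSum w ψ m) ∧
    (IsMiddle w (m.1 - m.2 - 1) ∨ IsMiddle w (m.1 - m.2 + 1))
  have hTne : T.Nonempty := by
    obtain ⟨⟨a, b⟩, hm, hmax⟩ := K.exists_max_image (weightedSum w ψ) hK
    by_cases hc : IsMiddle w (a - b - 1) ∨ IsMiddle w (a - b + 1)
    · exact ⟨(a, b), Finset.mem_filter.mpr ⟨hm, hmax, hc⟩⟩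
    · have hmid : IsMiddle w (a - b) := by
        obtain h | h | h : i % 3 = (a - b) % 3 ∨ i % 3 = (a - b - 1) % 3 ∨
          i % 3 = (a - b + 1) % 3 := by omega
        · exact hi.of_emod_eq hw h
        · exact absurd (Or.inl (hi.of_emod_eq hw h)) hc
        · exact absurd (Or.inr (hi.of_emod_eq hw h)) hc
      obtain ⟨-, h₁, -, h₂, -, -⟩ := hint _ hm hmax
      have heq := weightedSum_sub_fst_eq hw hmid (hψ _ hm) (hψ _ h₁) (hψ _ h₂) (hmax _ h₁)
        (hmax _ h₂)
      refine ⟨(a - 1, b), Finset.mem_filter.mpr ⟨h₁, fun m' hm' => heq ▸ hmax m' hm', .inr ?_⟩⟩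
      exact hmid.of_emod_eq hw (by simp only; omega)
  obtain ⟨⟨a, b⟩, hm, htop⟩ := T.exists_max_image (fun m => m.1 + m.2) hTne
  obtain ⟨hm, hmax, hc⟩ := Finset.mem_filter.mp hm
  obtain ⟨h₁, -, h₂, -, h₃, h₄⟩ := hint _ hm hmax
  rcases hc with hc | hc
  · have heq := weightedSum_add_fst_eq hw hc (hψ _ hm) (hψ _ h₁) (hψ _ h₃) (hmax _ h₁) (hmax _ h₃)
    have := htop (a + 1, b) (Finset.mem_filter.mpr ⟨h₁, fun m' hm' => heq ▸ hmax m' hm',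
      .inr (hc.of_emod_eq hw (by simp only; omega))⟩)
    simp only at this
    omega
  · have heq := weightedSum_add_snd_eq hw hc (hψ _ hm) (hψ _ h₂) (hψ _ h₄) (hmax _ h₂) (hmax _ h₄)
    have := htop (a, b + 1) (Finset.mem_filter.mpr ⟨h₂, fun m' hm' => heq ▸ hmax m' hm',
      .inl (hc.of_emod_eq hw (by simp only; omega))⟩)
    simp only at this
    omega

end Propagation

/-- The weights `p`, `q`, `0` on the colors `0`, `1`, `2`. -/
noncomputable def colorWeight (p q : ℝ) (i : ℤ) : ℝ :=
  if i % 3 = 0 then p else if i % 3 = 1 then q else 0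

theorem colorWeight_periodic (p q : ℝ) : Function.Periodic (colorWeight p q) 3 := fun i => by
  simp only [colorWeight, Int.add_emod_right]

theorem exists_isMiddle_colorWeight {p q : ℝ} (hp : p ≠ 0) (hq : q ≠ 0) (hpq : p ≠ q) :
    ∃ i, IsMiddle (colorWeight p q) i := by
  by_contra! h
  have h₀ := h 0
  have h₁ := h 1
  have h₂ := h 2
  norm_num [IsMiddle, colorWeight] at h₀ h₁ h₂
  rcases hp.lt_or_gt with hp | hp <;> rcases hq.lt_or_gt with hq | hq <;>
    rcases hpq.lt_or_gt with hpq | hpq <;> nlinarith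

theorem weightedSum_colorWeight (p q : ℝ) (ψ : ℤ × ℤ → ℝ) (m : ℤ × ℤ) :
    weightedSum (colorWeight p q) ψ m = p * (vpt ψ m).1 + q * (vpt ψ m).2 := by
  obtain ⟨a, b⟩ := m
  have hs : (a - 1 - b) % 3 = (a - b - 1) % 3 := by congr 1; ring
  obtain h | h | h : (a - b) % 3 = 0 ∨ (a - b) % 3 = 1 ∨ (a - b) % 3 = 2 := by omega
  · have h₁ : (a - b - 1) % 3 = 2 := by omega
    have h₂ : (a - b + 1) % 3 = 1 := by omega
    simp [weightedSum, colorWeight, vpt, pickColor, hs, h, h₁, h₂]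
  · have h₁ : (a - b - 1) % 3 = 0 := by omega
    have h₂ : (a - b + 1) % 3 = 2 := by omega
    simp [weightedSum, colorWeight, vpt, pickColor, hs, h, h₁, h₂, add_comm]
  · have h₁ : (a - b - 1) % 3 = 1 := by omega
    have h₂ : (a - b + 1) % 3 = 0 := by omega
    simp [weightedSum, colorWeight, vpt, pickColor, hs, h, h₁, h₂, add_comm]

/-- A point outside the convex hull of a finite planar set is strictly separated from it by a
linear functional whose coefficients are nonzero and distinct. -/
theorem exists_generic_separation {S : Set (ℝ × ℝ)} (hS : S.Finite) {x : ℝ × ℝ}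
    (hx : x ∉ convexHull ℝ S) :
    ∃ p q : ℝ, p ≠ 0 ∧ q ≠ 0 ∧ p ≠ q ∧ ∀ y ∈ S, p * y.1 + q * y.2 < p * x.1 + q * x.2 := by
  obtain ⟨f, u, hfu, hux⟩ := geometric_hahn_banach_closed_point (convex_convexHull ℝ S)
    (hS.isClosed_convexHull ℝ) hx
  have hf : ∀ y : ℝ × ℝ, f y = f (1, 0) * y.1 + f (0, 1) * y.2 := fun y => by
    conv_lhs => rw [show y = y.1 • ((1 : ℝ), (0 : ℝ)) + y.2 • ((0 : ℝ), (1 : ℝ)) by ext <;> simp]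
    rw [map_add, map_smul, map_smul, smul_eq_mul, smul_eq_mul]
    ring
  set p := f (1, 0)
  set q := f (0, 1)
  have hsep : ∀ᶠ t in nhds (0 : ℝ), ∀ y ∈ S,
      (p + t) * y.1 + (q + 2 * t) * y.2 < (p + t) * x.1 + (q + 2 * t) * x.2 := by
    rw [Filter.eventually_all_finite hS]
    intro y hy
    refine ContinuousAt.eventually_lt (by fun_prop) (by fun_prop) ?_
    simpa only [add_zero, mul_zero, ← hf] using (hfu y (subset_convexHull ℝ S hy)).trans hux
  obtain ⟨t, ht, hne⟩ :=
    (infinite_of_mem_nhds (0 : ℝ) hsep).exists_notMem_finset {-p, -q / 2, p - q}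
  simp only [Finset.mem_insert, Finset.mem_singleton, not_or] at hne
  obtain ⟨h₁, h₂, h₃⟩ := hne
  exact ⟨p + t, q + 2 * t, fun h => h₁ (by linarith), fun h => h₂ (by linarith),
    fun h => h₃ (by linarith), ht⟩

/-- Maximum principle on the triangular lattice: if `(Q⁺ψ)(m) = 0` for all `m` in a
finite set `K`, then the image `v_ψ(K) ⊆ ℝ²` lies in the convex hull of the image of
the non-internal elements of `K`. -/
theorem maximum_principle (K : Finset (ℤ × ℤ)) (ψ : ℤ × ℤ → ℝ)
    (hψ : ∀ m ∈ K, Qadj ψ m = 0) :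
    ∀ m ∈ K, vpt ψ m ∈ convexHull ℝ (vpt ψ '' {m' | m' ∈ K ∧ ¬ internal K m'}) := by
  intro m hm
  by_contra hx
  have hfin : (vpt ψ '' {m' | m' ∈ K ∧ ¬ internal K m'}).Finite :=
    (K.finite_toSet.subset fun _ h => h.1).image _
  obtain ⟨p, q, hp, hq, hpq, hsep⟩ := exists_generic_separation hfin hx
  obtain ⟨i, hi⟩ := exists_isMiddle_colorWeight hp hq hpq
  obtain ⟨m', hm', hint, hmax⟩ := exists_not_internal_forall_weightedSum_le
    (colorWeight_periodic p q) hi ⟨m, hm⟩ hψ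
  have hle := hmax m hm
  rw [weightedSum_colorWeight, weightedSum_colorWeight] at hle
  exact absurd (hsep _ ⟨m', ⟨hm', hint⟩, rfl⟩) (not_lt.mpr hle)
end

section
/- Local step of the maximum principle: let ψ : ℤ×ℤ → ℝ and m ∈ ℤ×ℤ be such that (Q⁺ψ) vanishes at m and at the six neighbors m+(1,0), m−(1,0), m+(0,1), m−(0,1), m+(1,−1), m+(−1,1). Then, in ℝ², the point v_ψ(m) lies on the segment joining v_ψ(m+(1,0)) and v_ψ(m+(0,1)), or on the segment joining v_ψ(m−(1,0)) and v_ψ(m+(−1,1)), or on the segment joining v_ψ(m−(0,1)) and v_ψ(m+(1,−1)). -/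
theorem mem_segment_of_add_smul {v p q d : ℝ × ℝ} {x y : ℝ} (hxy : x * y ≤ 0)
    (hp : p = v + x • d) (hq : q = v + y • d) : v ∈ segment ℝ p q := by
  have h : (0 : ℝ) ∈ segment ℝ x y := by
    rw [segment_eq_uIcc, Set.mem_uIcc]
    rcases mul_nonpos_iff.mp hxy with h | h
    · exact Or.inr ⟨h.2, h.1⟩
    · exact Or.inl h
  obtain ⟨a, b, ha, hb, hab, h⟩ := h
  refine ⟨a, b, ha, hb, hab, ?_⟩
  simp only [smul_eq_mul] at h
  calc a • p + b • q = (a + b) • v + (a * x + b * y) • d := by rw [hp, hq]; module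
    _ = v := by rw [hab, h, one_smul, zero_smul, add_zero]

theorem vpt_of_color_zero (ψ : ℤ × ℤ → ℝ) {i j : ℤ} (h : (i - j) % 3 = 0) :
    vpt ψ (i, j) = (ψ (i, j), ψ (i, j - 1)) := by
  have h' : (i - 1 - j) % 3 = 2 := by omega
  simp [vpt, pickColor, h, h']

theorem vpt_of_color_one (ψ : ℤ × ℤ → ℝ) {i j : ℤ} (h : (i - j) % 3 = 1) :
    vpt ψ (i, j) = (ψ (i - 1, j), ψ (i, j)) := by
  have h' : (i - 1 - j) % 3 = 0 := by omega
  simp [vpt, pickColor, h, h']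

theorem vpt_of_color_two (ψ : ℤ × ℤ → ℝ) {i j : ℤ} (h : (i - j) % 3 = 2) :
    vpt ψ (i, j) = (ψ (i, j - 1), ψ (i - 1, j)) := by
  have h' : (i - 1 - j) % 3 = 1 := by omega
  simp [vpt, pickColor, h, h']

/-- Two of any three real numbers have a nonnegative product. -/
theorem exists_pair_mul_nonneg (x y z : ℝ) : 0 ≤ x * y ∨ 0 ≤ z * y ∨ 0 ≤ z * x := by
  by_contra! h
  obtain ⟨hxy, hzy, hzx⟩ := h
  nlinarith [mul_pos_of_neg_of_neg hxy hzy, mul_nonneg (sq_nonneg y) (neg_nonneg.mpr hzx.le)]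

/-- Local step of the maximum principle: if `Q⁺ψ` vanishes at `m` and at its six
neighbors, then `v_ψ(m)` lies on one of the three segments joining the images of
opposite pairs of neighbors. -/
theorem maximum_principle_local_step (ψ : ℤ × ℤ → ℝ) (m : ℤ × ℤ)
    (h0 : Qadj ψ m = 0)
    (h1 : Qadj ψ (m.1 + 1, m.2) = 0) (h2 : Qadj ψ (m.1 - 1, m.2) = 0)
    (h3 : Qadj ψ (m.1, m.2 + 1) = 0) (h4 : Qadj ψ (m.1, m.2 - 1) = 0)
    (h5 : Qadj ψ (m.1 + 1, m.2 - 1) = 0) (h6 : Qadj ψ (m.1 - 1, m.2 + 1) = 0) :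
    vpt ψ m ∈ segment ℝ (vpt ψ (m.1 + 1, m.2)) (vpt ψ (m.1, m.2 + 1)) ∨
    vpt ψ m ∈ segment ℝ (vpt ψ (m.1 - 1, m.2)) (vpt ψ (m.1 - 1, m.2 + 1)) ∨
    vpt ψ m ∈ segment ℝ (vpt ψ (m.1, m.2 - 1)) (vpt ψ (m.1 + 1, m.2 - 1)) := by
  obtain ⟨i, j⟩ := m
  simp only [Qadj, add_sub_cancel_right] at *
  have descent {d₁ d₂ d₃ : ℝ × ℝ}
      (e₁ : vpt ψ (i + 1, j) = vpt ψ (i, j) + (ψ (i + 1, j - 1) - ψ (i - 1, j)) • d₁)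
      (f₁ : vpt ψ (i, j + 1) = vpt ψ (i, j) + (ψ (i, j - 1) - ψ (i - 1, j + 1)) • d₁)
      (e₂ : vpt ψ (i - 1, j) = vpt ψ (i, j) + (ψ (i - 1, j - 1) - ψ (i, j)) • d₂)
      (f₂ : vpt ψ (i - 1, j + 1) = vpt ψ (i, j) + (ψ (i, j - 1) - ψ (i - 1, j + 1)) • d₂)
      (e₃ : vpt ψ (i, j - 1) = vpt ψ (i, j) + (ψ (i - 1, j - 1) - ψ (i, j)) • d₃)
      (f₃ : vpt ψ (i + 1, j - 1) = vpt ψ (i, j) + (ψ (i - 1, j) - ψ (i + 1, j - 1)) • d₃) :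
      vpt ψ (i, j) ∈ segment ℝ (vpt ψ (i + 1, j)) (vpt ψ (i, j + 1)) ∨
      vpt ψ (i, j) ∈ segment ℝ (vpt ψ (i - 1, j)) (vpt ψ (i - 1, j + 1)) ∨
      vpt ψ (i, j) ∈ segment ℝ (vpt ψ (i, j - 1)) (vpt ψ (i + 1, j - 1)) := by
    rcases exists_pair_mul_nonneg (ψ (i + 1, j - 1) - ψ (i - 1, j))
      (ψ (i - 1, j + 1) - ψ (i, j - 1)) (ψ (i - 1, j - 1) - ψ (i, j)) with h | h | h
    · exact Or.inl (mem_segment_of_add_smul (by linarith) e₁ f₁)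
    · exact Or.inr (Or.inl (mem_segment_of_add_smul (by linarith) e₂ f₂))
    · exact Or.inr (Or.inr (mem_segment_of_add_smul (by linarith) e₃ f₃))
  have hcolor : (i - j) % 3 = 0 ∨ (i - j) % 3 = 1 ∨ (i - j) % 3 = 2 := by omega
  rcases hcolor with h | h | h
  · apply descent (d₁ := (0, -1)) (d₂ := (1, -1)) (d₃ := (1, 0)) <;>
      rw [vpt_of_color_zero ψ h]
    · rw [vpt_of_color_one ψ (by omega)]
      ext <;> simp
      linarith
    · rw [vpt_of_color_two ψ (by omega)]
      ext <;> simp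
    · rw [vpt_of_color_two ψ (by omega)]
      ext <;> simp
      linarith
    · rw [vpt_of_color_one ψ (by omega)]
      ext <;> simp
      linarith
    · rw [vpt_of_color_one ψ (by omega)]
      ext <;> simp
    · rw [vpt_of_color_two ψ (by omega)]
      ext <;> simp
      linarith
  · apply descent (d₁ := (1, 0)) (d₂ := (0, 1)) (d₃ := (-1, 1)) <;>
      rw [vpt_of_color_one ψ h]
    · rw [vpt_of_color_two ψ (by omega)]
      ext <;> simp
    · rw [vpt_of_color_zero ψ (by omega)]
      ext <;> simp
      linarith
    · rw [vpt_of_color_zero ψ (by omega)]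
      ext <;> simp
    · rw [vpt_of_color_two ψ (by omega)]
      ext <;> simp
      linarith
    · rw [vpt_of_color_two ψ (by omega)]
      ext <;> simp
      linarith
    · rw [vpt_of_color_zero ψ (by omega)]
      ext <;> simp
      linarith
  · apply descent (d₁ := (-1, 1)) (d₂ := (-1, 0)) (d₃ := (0, -1)) <;>
      rw [vpt_of_color_two ψ h]
    · rw [vpt_of_color_zero ψ (by omega)]
      ext <;> simp
      linarith
    · rw [vpt_of_color_one ψ (by omega)]
      ext <;> simp
      linarith
    · rw [vpt_of_color_one ψ (by omega)]
      ext <;> simp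
      linarith
    · rw [vpt_of_color_zero ψ (by omega)]
      ext <;> simp
    · rw [vpt_of_color_zero ψ (by omega)]
      ext <;> simp
      linarith
    · rw [vpt_of_color_one ψ (by omega)]
      ext <;> simp
end

section
/- Fix real numbers h, l₁₂, l₂₁ with l₁₂ + l₂₁ = h, set l₁₁ = l₂₂ = h/2 and q = exp(h/2), and let l₁(n₁,n₂) = l₁₁n₁ + l₁₂n₂, l₂(n₁,n₂) = l₂₁n₁ + l₂₂n₂. Then for all c, d ∈ ℝ, all ψ : ℤ×ℤ → ℝ and all n ∈ ℤ×ℤ: (Q(c,d)⁺(Q(c,d)ψ))(n) − ψ(n) = q² · ((Q(c/q², d/q²)(Q(c/q², d/q²)⁺ψ))(n) − ψ(n)). -/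
/-- The white-triangle operator with exponential coefficients:
`(Q(c,d)ψ)(n) = ψ(n) + c·exp(l₁(n))·ψ(n+(1,0)) + d·exp(l₂(n))·ψ(n+(0,1))`. -/
noncomputable def Qcd (l₁ l₂ : ℤ × ℤ → ℝ) (c d : ℝ) (ψ : ℤ × ℤ → ℝ) : ℤ × ℤ → ℝ :=
  fun n => ψ n + c * Real.exp (l₁ n) * ψ (n.1 + 1, n.2) + d * Real.exp (l₂ n) * ψ (n.1, n.2 + 1)

/-- The formal adjoint of `Q(c,d)`:
`(Q(c,d)⁺ψ)(n) = ψ(n) + c·exp(l₁(n−(1,0)))·ψ(n−(1,0)) + d·exp(l₂(n−(0,1)))·ψ(n−(0,1))`. -/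
noncomputable def QcdAdj (l₁ l₂ : ℤ × ℤ → ℝ) (c d : ℝ) (ψ : ℤ × ℤ → ℝ) : ℤ × ℤ → ℝ :=
  fun n => ψ n + c * Real.exp (l₁ (n.1 - 1, n.2)) * ψ (n.1 - 1, n.2)
    + d * Real.exp (l₂ (n.1, n.2 - 1)) * ψ (n.1, n.2 - 1)

/-- With `l₁₂ + l₂₁ = h`, `l₁₁ = l₂₂ = h/2`, `q = exp(h/2)`, and the linear forms
`l₁(n) = l₁₁n₁ + l₁₂n₂`, `l₂(n) = l₂₁n₁ + l₂₂n₂`, one has the operator identity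
`Q(c,d)⁺Q(c,d) − 1 = q²·(Q(c/q², d/q²)·Q(c/q², d/q²)⁺ − 1)`. -/
theorem exp_coeff_operator_identity (h l₁₂ l₂₁ : ℝ) (hsum : l₁₂ + l₂₁ = h)
    (c d : ℝ) (ψ : ℤ × ℤ → ℝ) (n : ℤ × ℤ) :
    QcdAdj (fun p => h / 2 * p.1 + l₁₂ * p.2) (fun p => l₂₁ * p.1 + h / 2 * p.2) c d
        (Qcd (fun p => h / 2 * p.1 + l₁₂ * p.2) (fun p => l₂₁ * p.1 + h / 2 * p.2) c d ψ) n
      - ψ n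
    = Real.exp (h / 2) ^ 2 *
        (Qcd (fun p => h / 2 * p.1 + l₁₂ * p.2) (fun p => l₂₁ * p.1 + h / 2 * p.2)
            (c / Real.exp (h / 2) ^ 2) (d / Real.exp (h / 2) ^ 2)
            (QcdAdj (fun p => h / 2 * p.1 + l₁₂ * p.2) (fun p => l₂₁ * p.1 + h / 2 * p.2)
              (c / Real.exp (h / 2) ^ 2) (d / Real.exp (h / 2) ^ 2) ψ) n
          - ψ n) := by
  obtain ⟨x, y⟩ := n
  subst hsum
  simp only [Qcd, QcdAdj]
  push_cast
  simp only [sub_add_cancel, add_sub_cancel_right]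
  set q := Real.exp ((l₁₂ + l₂₁) / 2) with hq
  set A := Real.exp ((l₁₂ + l₂₁) / 2 * (x : ℝ) + l₁₂ * y) with hA
  set B := Real.exp (l₂₁ * (x : ℝ) + (l₁₂ + l₂₁) / 2 * y) with hB
  set r := Real.exp l₁₂ with hr
  set s := Real.exp l₂₁ with hs
  have hrs : q ^ 2 = r * s := by
    rw [hq, hr, hs, ← Real.exp_add, ← Real.exp_nat_mul]
    congr 1
    push_cast
    ring
  have hq0 : q ≠ 0 := Real.exp_ne_zero _
  have hr0 : r ≠ 0 := Real.exp_ne_zero _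
  have hs0 : s ≠ 0 := Real.exp_ne_zero _
  have h₁ : Real.exp ((l₁₂ + l₂₁) / 2 * ((x : ℝ) - 1) + l₁₂ * y) = A / q := by
    rw [hA, hq, ← Real.exp_sub]
    ring_nf
  have h₂ : Real.exp (l₂₁ * (x : ℝ) + (l₁₂ + l₂₁) / 2 * ((y : ℝ) - 1)) = B / q := by
    rw [hB, hq, ← Real.exp_sub]
    ring_nf
  have h₃ : Real.exp (l₂₁ * ((x : ℝ) - 1) + (l₁₂ + l₂₁) / 2 * y) = B / s := by
    rw [hB, hs, ← Real.exp_sub]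
    ring_nf
  have h₄ : Real.exp ((l₁₂ + l₂₁) / 2 * (x : ℝ) + l₁₂ * ((y : ℝ) - 1)) = A / r := by
    rw [hA, hr, ← Real.exp_sub]
    ring_nf
  have h₅ : Real.exp ((l₁₂ + l₂₁) / 2 * ((x : ℝ) - 1) + l₁₂ * ((y : ℝ) + 1)) = A * r / q := by
    rw [hA, hq, hr, ← Real.exp_add, ← Real.exp_sub]
    ring_nf
  have h₆ : Real.exp (l₂₁ * ((x : ℝ) + 1) + (l₁₂ + l₂₁) / 2 * ((y : ℝ) - 1)) = B * s / q := by
    rw [hB, hq, hs, ← Real.exp_add, ← Real.exp_sub]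
    ring_nf
  rw [h₁, h₂, h₃, h₄, h₅, h₆]
  have hs' : s = q ^ 2 / r := by
    rw [hrs]
    field_simp
  rw [hs']
  field_simp
  ring
end

section
/- Unique black factorization of a discrete self-adjoint Schrödinger operator: let a, b, c, d : ℤ×ℤ → ℝ with b, c, d everywhere positive, and define the self-adjoint operator L on functions ψ : ℤ×ℤ → ℝ by (Lψ)(n) = a(n)ψ(n) + b(n)ψ(n+(1,0)) + c(n)ψ(n+(0,1)) + d(n)ψ(n+(−1,1)) + b(n−(1,0))ψ(n−(1,0)) + c(n−(0,1))ψ(n−(0,1)) + d(n+(1,−1))ψ(n+(1,−1)). Then there exist unique functions u, v, w : ℤ×ℤ → ℝ, all everywhere positive, and a unique U : ℤ×ℤ → ℝ, such that for all ψ and all n: (Lψ)(n) = (Q_b⁺(Q_bψ))(n) + U(n)ψ(n), where (Q_bψ)(n) = u(n)ψ(n) + v(n)ψ(n−(1,0)) + w(n)ψ(n−(0,1)) and (Q_b⁺φ)(n) = u(n)φ(n) + v(n+(1,0))φ(n+(1,0)) + w(n+(0,1))φ(n+(0,1)). -/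
/-- A 'black' first-order operator:
`(Q_bψ)(n) = u(n)ψ(n) + v(n)ψ(n−(1,0)) + w(n)ψ(n−(0,1))`. -/
def Qb (u v w : ℤ × ℤ → ℝ) (ψ : ℤ × ℤ → ℝ) : ℤ × ℤ → ℝ :=
  fun n => u n * ψ n + v n * ψ (n.1 - 1, n.2) + w n * ψ (n.1, n.2 - 1)

/-- The formal adjoint of a 'black' first-order operator:
`(Q_b⁺φ)(n) = u(n)φ(n) + v(n+(1,0))φ(n+(1,0)) + w(n+(0,1))φ(n+(0,1))`. -/
def QbAdj (u v w : ℤ × ℤ → ℝ) (φ : ℤ × ℤ → ℝ) : ℤ × ℤ → ℝ :=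
  fun n => u n * φ n + v (n.1 + 1, n.2) * φ (n.1 + 1, n.2) + w (n.1, n.2 + 1) * φ (n.1, n.2 + 1)

/-- The discrete self-adjoint Schrödinger operator `L` with coefficients `a, b, c, d`. -/
def Lop (a b c d : ℤ × ℤ → ℝ) (ψ : ℤ × ℤ → ℝ) : ℤ × ℤ → ℝ := fun n =>
  a n * ψ n + b n * ψ (n.1 + 1, n.2) + c n * ψ (n.1, n.2 + 1) + d n * ψ (n.1 - 1, n.2 + 1)
    + b (n.1 - 1, n.2) * ψ (n.1 - 1, n.2) + c (n.1, n.2 - 1) * ψ (n.1, n.2 - 1)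
    + d (n.1 + 1, n.2 - 1) * ψ (n.1 + 1, n.2 - 1)

/-- Positive reals with prescribed positive pairwise products exist. -/
theorem exists_pos_pairwise_mul_eq {B C D : ℝ} (hB : 0 < B) (hC : 0 < C) (hD : 0 < D) :
    ∃ x y z : ℝ, (0 < x ∧ 0 < y ∧ 0 < z) ∧ x * y = B ∧ x * z = C ∧ y * z = D := by
  have hx : 0 < √(B * C / D) := by positivity
  have hsq : √(B * C / D) ^ 2 = B * C / D := Real.sq_sqrt (by positivity)
  refine ⟨√(B * C / D), B / √(B * C / D), C / √(B * C / D),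
    ⟨hx, by positivity, by positivity⟩, by field_simp, by field_simp, ?_⟩
  rw [div_mul_div_comm, ← sq, hsq]
  field_simp

/-- Positive reals are determined by their pairwise products. -/
theorem eq_of_pairwise_mul_eq {x y z x' y' z' : ℝ} (hx : 0 < x) (hy : 0 < y) (hz : 0 < z)
    (hx' : 0 < x') (hxy : x' * y' = x * y) (hxz : x' * z' = x * z) (hyz : y' * z' = y * z) :
    x' = x ∧ y' = y ∧ z' = z := by
  have hsq : x' ^ 2 = x ^ 2 := by
    have h : x' ^ 2 * (y * z) = x ^ 2 * (y * z) := by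
      rw [← hyz]
      linear_combination x' * z' * hxy + x * y * hxz - x ^ 2 * hyz
    exact mul_right_cancel₀ (mul_pos hy hz).ne' h
  have h : x' = x := (pow_left_inj₀ hx'.le hx.le two_ne_zero).1 hsq
  subst h
  exact ⟨rfl, mul_left_cancel₀ hx.ne' hxy, mul_left_cancel₀ hx.ne' hxz⟩

/-- The factorization `L = Q_b⁺Q_b + U` amounts to pointwise equations between coefficients. -/
theorem Lop_eq_QbAdj_Qb_add_iff (a b c d u v w U : ℤ × ℤ → ℝ) :
    (∀ ψ n, Lop a b c d ψ n = QbAdj u v w (Qb u v w ψ) n + U n * ψ n) ↔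
      ∀ i j : ℤ, u (i, j) * v (i, j) = b (i - 1, j) ∧ u (i, j) * w (i, j) = c (i, j - 1) ∧
        v (i, j) * w (i, j) = d (i, j - 1) ∧
        U (i, j) = a (i, j) - u (i, j) ^ 2 - v (i + 1, j) ^ 2 - w (i, j + 1) ^ 2 := by
  constructor
  · intro h i j
    have h₁ := h (Pi.single (i - 1, j) 1) (i, j)
    have h₂ := h (Pi.single (i, j - 1) 1) (i, j)
    have h₃ := h (Pi.single (i, j - 1) 1) (i - 1, j)
    have h₄ := h (Pi.single (i, j) 1) (i, j)
    simp [Lop, Qb, QbAdj, sub_eq_add_neg, add_assoc] at h₁ h₂ h₃ h₄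
    simp only [sub_eq_add_neg]
    refine ⟨?_, ?_, ?_, ?_⟩ <;> linarith
  · rintro h ψ ⟨i, j⟩
    obtain ⟨h₁, h₂, -, h₄⟩ := h i j
    obtain ⟨h₅, -, h₆, -⟩ := h (i + 1) j
    obtain ⟨-, h₇, h₈, -⟩ := h i (j + 1)
    simp only [add_sub_cancel_right] at h₅ h₇ h₈
    simp only [Lop, Qb, QbAdj, add_sub_cancel_right, ← h₁, ← h₂, h₄, ← h₅, ← h₆, ← h₇, ← h₈]
    ring

/-- Unique black factorization `L = Q_b⁺Q_b + U` of a discrete self-adjoint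
Schrödinger operator with positive off-diagonal coefficients. -/
theorem unique_black_factorization (a b c d : ℤ × ℤ → ℝ)
    (hb : ∀ n, 0 < b n) (hc : ∀ n, 0 < c n) (hd : ∀ n, 0 < d n) :
    ∃ u v w U : ℤ × ℤ → ℝ,
      ((∀ n, 0 < u n) ∧ (∀ n, 0 < v n) ∧ (∀ n, 0 < w n)) ∧
      (∀ ψ n, Lop a b c d ψ n = QbAdj u v w (Qb u v w ψ) n + U n * ψ n) ∧
      ∀ u' v' w' U' : ℤ × ℤ → ℝ,
        ((∀ n, 0 < u' n) ∧ (∀ n, 0 < v' n) ∧ (∀ n, 0 < w' n)) →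
        (∀ ψ n, Lop a b c d ψ n = QbAdj u' v' w' (Qb u' v' w' ψ) n + U' n * ψ n) →
        u' = u ∧ v' = v ∧ w' = w ∧ U' = U := by
  choose u v w hpos huv huw hvw using fun n : ℤ × ℤ =>
    exists_pos_pairwise_mul_eq (hb (n.1 - 1, n.2)) (hc (n.1, n.2 - 1)) (hd (n.1, n.2 - 1))
  have key : ∀ ψ n, Lop a b c d ψ n = QbAdj u v w (Qb u v w ψ) n +
      (fun n => a n - u n ^ 2 - v (n.1 + 1, n.2) ^ 2 - w (n.1, n.2 + 1) ^ 2) n * ψ n :=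
    (Lop_eq_QbAdj_Qb_add_iff ..).2 fun i j => ⟨huv _, huw _, hvw _, rfl⟩
  refine ⟨u, v, w, _, ⟨fun n => (hpos n).1, fun n => (hpos n).2.1, fun n => (hpos n).2.2⟩,
    key, fun u' v' w' U' ⟨hu', _, _⟩ h' => ?_⟩
  rw [Lop_eq_QbAdj_Qb_add_iff] at h'
  have heq : ∀ n, u' n = u n ∧ v' n = v n ∧ w' n = w n := fun n =>
    eq_of_pairwise_mul_eq (hpos n).1 (hpos n).2.1 (hpos n).2.2 (hu' n)
      ((h' n.1 n.2).1.trans (huv n).symm) ((h' n.1 n.2).2.1.trans (huw n).symm)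
      ((h' n.1 n.2).2.2.1.trans (hvw n).symm)
  obtain rfl : u' = u := funext fun n => (heq n).1
  obtain rfl : v' = v := funext fun n => (heq n).2.1
  obtain rfl : w' = w := funext fun n => (heq n).2.2
  exact ⟨rfl, rfl, rfl, funext fun n => (h' n.1 n.2).2.2.2⟩
end

section
/- Unique white factorization of a discrete self-adjoint Schrödinger operator: let a, b, c, d : ℤ×ℤ → ℝ with b, c, d everywhere positive, and define the self-adjoint operator L on functions ψ : ℤ×ℤ → ℝ by (Lψ)(n) = a(n)ψ(n) + b(n)ψ(n+(1,0)) + c(n)ψ(n+(0,1)) + d(n)ψ(n+(−1,1)) + b(n−(1,0))ψ(n−(1,0)) + c(n−(0,1))ψ(n−(0,1)) + d(n+(1,−1))ψ(n+(1,−1)). Then there exist unique functions x, y, z : ℤ×ℤ → ℝ, all everywhere positive, and a unique V : ℤ×ℤ → ℝ, such that for all ψ and all n: (Lψ)(n) = (Q_w⁺(Q_wψ))(n) + V(n)ψ(n), where (Q_wψ)(n) = x(n)ψ(n) + y(n)ψ(n+(1,0)) + z(n)ψ(n+(0,1)) and (Q_w⁺φ)(n) = x(n)φ(n) + y(n−(1,0))φ(n−(1,0))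 + z(n−(0,1))φ(n−(0,1)). -/
/-- A 'white' first-order operator:
`(Q_wψ)(n) = x(n)ψ(n) + y(n)ψ(n+(1,0)) + z(n)ψ(n+(0,1))`. -/
def Qw (x y z : ℤ × ℤ → ℝ) (ψ : ℤ × ℤ → ℝ) : ℤ × ℤ → ℝ :=
  fun n => x n * ψ n + y n * ψ (n.1 + 1, n.2) + z n * ψ (n.1, n.2 + 1)

/-- The formal adjoint of a 'white' first-order operator:
`(Q_w⁺φ)(n) = x(n)φ(n) + y(n−(1,0))φ(n−(1,0)) + z(n−(0,1))φ(n−(0,1))`. -/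
def QwAdj (x y z : ℤ × ℤ → ℝ) (φ : ℤ × ℤ → ℝ) : ℤ × ℤ → ℝ :=
  fun n => x n * φ n + y (n.1 - 1, n.2) * φ (n.1 - 1, n.2) + z (n.1, n.2 - 1) * φ (n.1, n.2 - 1)

/-- Comparing coefficients: `L = Q_w⁺Q_w + V` is equivalent to a pointwise system of equations. -/
theorem Lop_eq_QwAdj_Qw_add_iff (a b c d x y z V : ℤ × ℤ → ℝ) :
    (∀ ψ n, Lop a b c d ψ n = QwAdj x y z (Qw x y z ψ) n + V n * ψ n) ↔
      ∀ n : ℤ × ℤ, x n * y n = b n ∧ x n * z n = c n ∧ y n * z n = d (n.1 + 1, n.2) ∧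
        V n = a n - x n ^ 2 - y (n.1 - 1, n.2) ^ 2 - z (n.1, n.2 - 1) ^ 2 := by
  constructor
  · rintro h ⟨i, j⟩
    have h₁ := h (fun p => if p = (i + 1, j) then 1 else 0) (i, j)
    have h₂ := h (fun p => if p = (i, j + 1) then 1 else 0) (i, j)
    have h₃ := h (fun p => if p = (i, j + 1) then 1 else 0) (i + 1, j)
    have h₄ := h (fun p => if p = (i, j) then 1 else 0) (i, j)
    have e₁ : i - 1 ≠ i + 1 := by omega
    have e₂ : j - 1 ≠ j + 1 := by omega
    have e₃ : i + 1 + 1 ≠ i := by omega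
    have e₄ : j ≠ j + 1 := by omega
    simp [Lop, QwAdj, Qw, e₁, e₂, e₃, e₄] at h₁ h₂ h₃ h₄
    exact ⟨h₁.symm, h₂.symm, h₃.symm, by linarith⟩
  · rintro h ψ ⟨i, j⟩
    obtain ⟨hb, hc, -, hV⟩ := h (i, j)
    obtain ⟨hb', -, hd, -⟩ := h (i - 1, j)
    obtain ⟨-, hc', hd', -⟩ := h (i, j - 1)
    simp only [sub_add_cancel] at hd
    simp only [Lop, QwAdj, Qw, sub_add_cancel, ← hb, ← hc, ← hb', ← hc', ← hd, ← hd', hV]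
    ring

/-- Unique white factorization `L = Q_w⁺Q_w + V` of a discrete self-adjoint
Schrödinger operator with positive off-diagonal coefficients. -/
theorem unique_white_factorization (a b c d : ℤ × ℤ → ℝ)
    (hb : ∀ n, 0 < b n) (hc : ∀ n, 0 < c n) (hd : ∀ n, 0 < d n) :
    ∃ x y z V : ℤ × ℤ → ℝ,
      ((∀ n, 0 < x n) ∧ (∀ n, 0 < y n) ∧ (∀ n, 0 < z n)) ∧
      (∀ ψ n, Lop a b c d ψ n = QwAdj x y z (Qw x y z ψ) n + V n * ψ n) ∧
      ∀ x' y' z' V' : ℤ × ℤ → ℝ,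
        ((∀ n, 0 < x' n) ∧ (∀ n, 0 < y' n) ∧ (∀ n, 0 < z' n)) →
        (∀ ψ n, Lop a b c d ψ n = QwAdj x' y' z' (Qw x' y' z' ψ) n + V' n * ψ n) →
        x' = x ∧ y' = y ∧ z' = z ∧ V' = V := by
  set x : ℤ × ℤ → ℝ := fun n => √(b n * c n / d (n.1 + 1, n.2)) with hx_def
  have hx : ∀ n, 0 < x n := fun n =>
    Real.sqrt_pos.2 (div_pos (mul_pos (hb n) (hc n)) (hd _))
  have hx_sq : ∀ n, x n ^ 2 = b n * c n / d (n.1 + 1, n.2) := fun n =>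
    Real.sq_sqrt (div_pos (mul_pos (hb n) (hc n)) (hd _)).le
  refine ⟨x, fun n => b n / x n, fun n => c n / x n,
    fun n => a n - x n ^ 2 - (b (n.1 - 1, n.2) / x (n.1 - 1, n.2)) ^ 2
      - (c (n.1, n.2 - 1) / x (n.1, n.2 - 1)) ^ 2,
    ⟨hx, fun n => div_pos (hb n) (hx n), fun n => div_pos (hc n) (hx n)⟩, ?_, ?_⟩
  · refine (Lop_eq_QwAdj_Qw_add_iff ..).2 fun n =>
      ⟨mul_div_cancel₀ _ (hx n).ne', mul_div_cancel₀ _ (hx n).ne', ?_, rfl⟩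
    have := (hb n).ne'
    have := (hc n).ne'
    have := (hd (n.1 + 1, n.2)).ne'
    rw [div_mul_div_comm, ← pow_two, hx_sq]
    field_simp
  · rintro x' y' z' V' ⟨hx', hy', hz'⟩ h
    rw [Lop_eq_QwAdj_Qw_add_iff] at h
    have hxx : x' = x := by
      funext n
      obtain ⟨hxy, hxz, hyz, -⟩ := h n
      have := (hy' n).ne'
      have := (hz' n).ne'
      refine (pow_left_inj₀ (hx' n).le (hx n).le two_ne_zero).1 ?_
      rw [hx_sq, ← hxy, ← hxz, ← hyz]
      field_simp
    have hyy : y' = fun n => b n / x n := by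
      funext n
      rw [eq_div_iff (hx n).ne', mul_comm, ← hxx, (h n).1]
    have hzz : z' = fun n => c n / x n := by
      funext n
      rw [eq_div_iff (hx n).ne', mul_comm, ← hxx, (h n).2.1]
    refine ⟨hxx, hyy, hzz, ?_⟩
    funext n
    rw [(h n).2.2.2, hxx, hyy, hzz]
end

section
/- Let k ≥ 1, n = (n₁,n₂) ∈ ℤ×ℤ, and suppose p₁, p₂, p₃ ∈ 𝒫ₖ have shapes (k,1), (k,2), (k,3) respectively at n. Then p₁ + p₂ + p₃ ∈ 𝒫ₖ₋₁, i.e. Q⁺(p₁+p₂+p₃) = 0 and Q^k(p₁+p₂+p₃) = 0. -/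
/-- The `j`-th point (for `j = 0,…,2k+1`) of the side of `T_n^{(k)}` corresponding to
shape index `i ∈ {1,2,3}` (encoded as `i : Fin 3`, `0 ↔ 1`, `1 ↔ 2`, `2 ↔ 3`):
side 1 is `(n₁−2k−1+j, n₂)`, side 2 is `(n₁, n₂−j)`, side 3 is `(n₁−j, n₂−2k−1+j)`. -/
def sidePt (k : ℕ) (i : Fin 3) (n : ℤ × ℤ) (j : ℕ) : ℤ × ℤ :=
  match i with
  | 0 => (n.1 - (2 * k + 1) + j, n.2)
  | 1 => (n.1, n.2 - j)
  | 2 => (n.1 - j, n.2 - (2 * k + 1) + j)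

/-- `p` has shape `(k, i)` at `n`: it equals `(−1)^{j+k}` at the `j`-th point of the
corresponding side of `T_n^{(k)}` and vanishes at all other points of `T_n^{(k)}`. -/
def hasShape (k : ℕ) (i : Fin 3) (n : ℤ × ℤ) (p : ℤ × ℤ → ℝ) : Prop :=
  (∀ j : ℕ, j ≤ 2 * k + 1 → p (sidePt k i n j) = (-1 : ℝ) ^ (j + k)) ∧
  ∀ x ∈ bigT n k, (∀ j : ℕ, j ≤ 2 * k + 1 → x ≠ sidePt k i n j) → p x = 0

theorem Qop_add (f g : ℤ × ℤ → ℝ) : Qop (f + g) = Qop f + Qop g := by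
  funext x
  simp only [Qop, Pi.add_apply]
  ring

theorem Qadj_add (f g : ℤ × ℤ → ℝ) : Qadj (f + g) = Qadj f + Qadj g := by
  funext x
  simp only [Qadj, Pi.add_apply]
  ring

theorem Qop_iterate_add (k : ℕ) (f g : ℤ × ℤ → ℝ) :
    Qop^[k] (f + g) = Qop^[k] f + Qop^[k] g := by
  induction k generalizing f g with
  | zero => rfl
  | succ k ih => simp only [Function.iterate_succ_apply, Qop_add, ih]

theorem Qadj_Qop_comm_s14 : Function.Commute Qadj Qop := by
  intro f
  funext x
  simp only [Qadj, Qop, add_sub_cancel_right, sub_add_cancel]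
  ring

theorem Qadj_Qop_iterate_eq_zero {f : ℤ × ℤ → ℝ} (hf : Qadj f = 0) (k : ℕ) :
    Qadj (Qop^[k] f) = 0 := by
  induction k with
  | zero => exact hf
  | succ k ih =>
    rw [Function.iterate_succ_apply', Qadj_Qop_comm_s14.eq, ih]
    funext x
    simp [Qop]

theorem Qop_iterate_succ_apply (k : ℕ) (f : ℤ × ℤ → ℝ) (a b : ℤ) :
    Qop^[k + 1] f (a, b) =
      Qop^[k] f (a, b) + Qop^[k] f (a + 1, b) + Qop^[k] f (a, b + 1) := by
  rw [Function.iterate_succ_apply']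
  rfl

/-- `(Q^k f)(a, b)` depends only on the values of `f` on a white triangle of side `k`. -/
theorem Qop_iterate_eq_zero {k : ℕ} {f : ℤ × ℤ → ℝ} {a b : ℤ}
    (h : ∀ x y, a ≤ x → b ≤ y → x + y ≤ a + b + k → f (x, y) = 0) :
    Qop^[k] f (a, b) = 0 := by
  induction k generalizing a b with
  | zero => exact h a b le_rfl le_rfl (by simp)
  | succ k ih =>
    push_cast at h
    rw [Qop_iterate_succ_apply, ih, ih, ih]
    · simp
    all_goals
      intro x y hx hy hxy
      exact h x y (by omega) (by omega) (by omega)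

theorem Qop_iterate_eq_corner {k : ℕ} {f : ℤ × ℤ → ℝ} {a b : ℤ}
    (h : ∀ x y, a ≤ x → b ≤ y → x + y ≤ a + b + k → a + b < x + y → f (x, y) = 0) :
    Qop^[k] f (a, b) = f (a, b) := by
  induction k with
  | zero => rfl
  | succ k ih =>
    push_cast at h
    rw [Qop_iterate_succ_apply, ih, Qop_iterate_eq_zero, Qop_iterate_eq_zero]
    · simp
    all_goals
      intros
      apply h <;> omega

theorem Qop_iterate_eq_right_corner {k : ℕ} {f : ℤ × ℤ → ℝ} {a b : ℤ}
    (h : ∀ x y, a ≤ x → b ≤ y → x + y ≤ a + b + k → x < a + k → f (x, y) = 0) :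
    Qop^[k] f (a, b) = f (a + k, b) := by
  induction k generalizing a with
  | zero => simp
  | succ k ih =>
    push_cast at h
    rw [Qop_iterate_succ_apply, ih (a := a + 1), Qop_iterate_eq_zero, Qop_iterate_eq_zero]
    · simp [add_assoc, add_comm (1 : ℤ)]
    all_goals
      intros
      apply h <;> omega

theorem Qop_iterate_eq_upper_corner {k : ℕ} {f : ℤ × ℤ → ℝ} {a b : ℤ}
    (h : ∀ x y, a ≤ x → b ≤ y → x + y ≤ a + b + k → y < b + k → f (x, y) = 0) :
    Qop^[k] f (a, b) = f (a, b + k) := by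
  induction k generalizing b with
  | zero => simp
  | succ k ih =>
    push_cast at h
    rw [Qop_iterate_succ_apply, ih (b := b + 1), Qop_iterate_eq_zero, Qop_iterate_eq_zero]
    · simp [add_assoc, add_comm (1 : ℤ)]
    all_goals
      intros
      apply h <;> omega

/-- A discrete polynomial of degree `0` vanishing at two adjacent points is zero. -/
theorem eq_zero_of_Qadj_of_Qop {f : ℤ × ℤ → ℝ} (hadj : Qadj f = 0) (hop : Qop f = 0)
    {a b : ℤ} (h₀ : f (a, b) = 0) (h₁ : f (a - 1, b) = 0) : f = 0 := by
  have hadj' (x y : ℤ) : f (x, y) + f (x - 1, y) + f (x, y - 1) = 0 := congrFun hadj (x, y)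
  have hop' (x y : ℤ) : f (x, y) + f (x + 1, y) + f (x, y + 1) = 0 := congrFun hop (x, y)
  have diag (x y : ℤ) : f (x + 1, y + 1) = f (x, y) := by
    have h := hadj' (x + 1) (y + 1)
    simp only [add_sub_cancel_right] at h
    linarith [hop' x y]
  have row (x y : ℤ) : f (x, y) + f (x - 1, y) + f (x + 1, y) = 0 := by
    have h := diag x (y - 1)
    rw [sub_add_cancel] at h
    linarith [hadj' x y]
  have base (x : ℤ) : f (x, b) = 0 ∧ f (x - 1, b) = 0 := by
    induction x using Int.inductionOn' (b := a) with
    | zero => exact ⟨h₀, h₁⟩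
    | succ x _ ih =>
      rw [add_sub_cancel_right]
      exact ⟨by linarith [row x b], ih.1⟩
    | pred x _ ih =>
      have h := row (x - 1) b
      rw [sub_add_cancel] at h
      exact ⟨ih.2, by linarith⟩
  have all (y : ℤ) : ∀ x, f (x, y) = 0 := by
    induction y using Int.inductionOn' (b := b) with
    | zero => exact fun x => (base x).1
    | succ y _ ih =>
      intro x
      linarith [hop' x y, ih x, ih (x + 1)]
    | pred y _ ih =>
      intro x
      linarith [hadj' x y, ih x, ih (x - 1)]
  funext ⟨x, y⟩
  exact all y x

theorem mem_bigT {n : ℤ × ℤ} {k : ℕ} {x y : ℤ} (hx : x ≤ n.1) (hy : y ≤ n.2)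
    (hxy : n.1 + n.2 ≤ x + y + (2 * k + 1)) : (x, y) ∈ bigT n k :=
  ⟨(n.1 - x).toNat, (n.2 - y).toNat, by omega, by ext <;> simp <;> omega⟩

theorem hasShape.iterate_zero {k : ℕ} {a b : ℤ} {p : ℤ × ℤ → ℝ}
    (h : hasShape k 0 (a, b) p) :
    Qop^[k] p (a - k, b - k) = -1 ∧ Qop^[k] p (a - k - 1, b - k) = 1 := by
  have van (x y : ℤ) (hx : x ≤ a) (hy : y < b) (hxy : a + b ≤ x + y + (2 * k + 1)) :
      p (x, y) = 0 :=
    h.2 _ (mem_bigT hx hy.le hxy) fun j _ hj => by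
      simp only [sidePt, Prod.mk.injEq] at hj
      omega
  constructor
  · rw [Qop_iterate_eq_upper_corner fun x y _ _ _ _ => van x y (by omega) (by omega) (by omega)]
    convert h.1 (k + 1) (by omega) using 2
    · simp only [sidePt, Prod.mk.injEq]; omega
    · exact (Odd.neg_one_pow ⟨k, by ring⟩).symm
  · rw [Qop_iterate_eq_upper_corner fun x y _ _ _ _ => van x y (by omega) (by omega) (by omega)]
    convert h.1 k (by omega) using 2
    · simp only [sidePt, Prod.mk.injEq]; omega
    · exact (Even.neg_one_pow ⟨k, rfl⟩).symm

theorem hasShape.iterate_one {k : ℕ} {a b : ℤ} {p : ℤ × ℤ → ℝ}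
    (h : hasShape k 1 (a, b) p) :
    Qop^[k] p (a - k, b - k) = 1 ∧ Qop^[k] p (a - k - 1, b - k) = 0 := by
  have van (x y : ℤ) (hx : x < a) (hy : y ≤ b) (hxy : a + b ≤ x + y + (2 * k + 1)) :
      p (x, y) = 0 :=
    h.2 _ (mem_bigT hx.le hy hxy) fun j _ hj => by
      simp only [sidePt, Prod.mk.injEq] at hj
      omega
  constructor
  · rw [Qop_iterate_eq_right_corner fun x y _ _ _ _ => van x y (by omega) (by omega) (by omega)]
    convert h.1 k (by omega) using 2
    · simp [sidePt]
    · exact (Even.neg_one_pow ⟨k, rfl⟩).symm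
  · exact Qop_iterate_eq_zero fun x y _ _ _ => van x y (by omega) (by omega) (by omega)

theorem hasShape.iterate_two {k : ℕ} {a b : ℤ} {p : ℤ × ℤ → ℝ}
    (h : hasShape k 2 (a, b) p) :
    Qop^[k] p (a - k, b - k) = 0 ∧ Qop^[k] p (a - k - 1, b - k) = -1 := by
  have van (x y : ℤ) (hx : x ≤ a) (hy : y ≤ b) (hxy : a + b < x + y + (2 * k + 1)) :
      p (x, y) = 0 :=
    h.2 _ (mem_bigT hx hy hxy.le) fun j _ hj => by
      simp only [sidePt, Prod.mk.injEq] at hj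
      omega
  constructor
  · exact Qop_iterate_eq_zero fun x y _ _ _ => van x y (by omega) (by omega) (by omega)
  · rw [Qop_iterate_eq_corner fun x y _ _ _ _ => van x y (by omega) (by omega) (by omega)]
    convert h.1 (k + 1) (by omega) using 2
    · simp only [sidePt, Prod.mk.injEq]; omega
    · exact (Odd.neg_one_pow ⟨k, by ring⟩).symm

/-- The three basic "polynomials" `p_{k,1}, p_{k,2}, p_{k,3}` associated with a big
black triangle sum up to a polynomial of degree `≤ k−1`:
`Q⁺(p₁+p₂+p₃) = 0` and `Q^k(p₁+p₂+p₃) = 0`. -/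
theorem shapes_sum_lower_degree (k : ℕ) (hk : 1 ≤ k) (n : ℤ × ℤ)
    (p₁ p₂ p₃ : ℤ × ℤ → ℝ)
    (hp₁ : Qadj p₁ = 0 ∧ Qop^[k + 1] p₁ = 0) (hs₁ : hasShape k 0 n p₁)
    (hp₂ : Qadj p₂ = 0 ∧ Qop^[k + 1] p₂ = 0) (hs₂ : hasShape k 1 n p₂)
    (hp₃ : Qadj p₃ = 0 ∧ Qop^[k + 1] p₃ = 0) (hs₃ : hasShape k 2 n p₃) :
    Qadj (p₁ + p₂ + p₃) = 0 ∧ Qop^[k] (p₁ + p₂ + p₃) = 0 := by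
  have hadj : Qadj (p₁ + p₂ + p₃) = 0 := by
    simp [Qadj_add, hp₁.1, hp₂.1, hp₃.1]
  refine ⟨hadj, ?_⟩
  obtain ⟨a, b⟩ := n
  refine eq_zero_of_Qadj_of_Qop (a := a - k) (b := b - k)
    (Qadj_Qop_iterate_eq_zero hadj k) ?_ ?_ ?_
  · rw [← Function.iterate_succ_apply' Qop]
    simp [Qop_iterate_add, hp₁.2, hp₂.2, hp₃.2, -Function.iterate_succ]
  · simp [Qop_iterate_add, hs₁.iterate_zero.1, hs₂.iterate_one.1, hs₃.iterate_two.1]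
  · simp [Qop_iterate_add, hs₁.iterate_zero.2, hs₂.iterate_one.2, hs₃.iterate_two.2]
end

section
/- Let k ≥ 1, n = (n₁,n₂) ∈ ℤ×ℤ, i ∈ {1,2,3}, and suppose p ∈ 𝒫ₖ has shape (k,i) at n. Then Qp ∈ 𝒫ₖ₋₁ and Qp has shape (k−1,i) at the point (n₁−1, n₂−1). -/
theorem Qop_zero : Qop 0 = 0 := by
  funext x
  simp [Qop]

/-- A function with a shape vanishes at the points of the big triangle off its side. -/
theorem hasShape.eq_zero {k : ℕ} {i : Fin 3} {n : ℤ × ℤ} {p : ℤ × ℤ → ℝ} (hs : hasShape k i n p)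
    {x y : ℤ} (hx : x ≤ n.1) (hy : y ≤ n.2) (hxy : n.1 + n.2 ≤ x + y + (2 * k + 1))
    (hside : ∀ j : ℕ, j ≤ 2 * k + 1 → (x, y) ≠ sidePt k i n j) : p (x, y) = 0 :=
  hs.2 _ ⟨(n.1 - x).toNat, (n.2 - y).toNat, by omega, Prod.ext (by simp; omega) (by simp; omega)⟩
    hside

/-- `Q` lowers the order of a shape by one and moves its corner by `(-1, -1)`. -/
theorem hasShape.Qop_apply {m : ℕ} {i : Fin 3} {n : ℤ × ℤ} {p : ℤ × ℤ → ℝ}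
    (hs : hasShape (m + 1) i n p) : hasShape m i (n.1 - 1, n.2 - 1) (Qop p) := by
  have sign (j : ℕ) : (-1 : ℝ) ^ (j + m) = (-1) ^ (j + 1 + (m + 1)) := by ring
  obtain ⟨a, b⟩ := n
  refine ⟨fun j hj => ?_, ?_⟩
  · have h := hs.1 (j + 1) (by omega)
    rw [sign, ← h]
    fin_cases i <;> simp only [Qop, sidePt] <;> push_cast
    · rw [hs.eq_zero, hs.eq_zero, zero_add, zero_add]
      · congr 2 <;> ring
      all_goals simp [sidePt] <;> omega
    · rw [hs.eq_zero, hs.eq_zero (y := b - 1 - j + 1), zero_add, add_zero]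
      · congr 2 <;> ring
      all_goals simp [sidePt] <;> omega
    · rw [hs.eq_zero (x := a - 1 - j + 1), hs.eq_zero (y := _ + 1), add_zero, add_zero]
      · congr 2 <;> ring
      all_goals (simp [sidePt]; omega)
  · rintro _ ⟨c, d, hcd, rfl⟩ hside
    have hoff : ∀ j : ℕ, j ≤ 2 * m + 1 →
        ¬ ((a - 1 - c, b - 1 - d) : ℤ × ℤ) = sidePt m i (a - 1, b - 1) j := hside
    have hc := hoff c (by omega)
    have hd := hoff d (by omega)
    have hc' := hoff (2 * m + 1 - c) (by omega)
    simp only [Qop]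
    rw [hs.eq_zero, hs.eq_zero, hs.eq_zero, add_zero, add_zero]
    all_goals fin_cases i <;> simp [sidePt] at * <;> omega

/-- Applying `Q` to the basic "polynomial" of shape `(k, i)` at `n` yields a
polynomial of degree `≤ k−1` of shape `(k−1, i)` at `(n₁−1, n₂−1)`:
`Qp ∈ 𝒫ₖ₋₁` and `Qp` has shape `(k−1, i)` at `(n₁−1, n₂−1)`. -/
theorem Q_of_shape (k : ℕ) (hk : 1 ≤ k) (n : ℤ × ℤ) (i : Fin 3) (p : ℤ × ℤ → ℝ)
    (hp : Qadj p = 0 ∧ Qop^[k + 1] p = 0) (hs : hasShape k i n p) :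
    (Qadj (Qop p) = 0 ∧ Qop^[k] (Qop p) = 0) ∧
      hasShape (k - 1) i (n.1 - 1, n.2 - 1) (Qop p) := by
  obtain ⟨m, rfl⟩ := Nat.exists_eq_add_of_le' hk
  exact ⟨⟨by rw [Qadj_Qop_comm, hp.1, Qop_zero], hp.2⟩, hs.Qop_apply⟩
end

section
/- Let k ≥ 0, n = (n₁,n₂) ∈ ℤ×ℤ, and let ψ : ℤ×ℤ → ℝ vanish at every point of the big black triangle T_n^{(k)}. Then the k-th derivative Q^kψ vanishes at the three points (n₁−k, n₂−k), (n₁−k−1, n₂−k), and (n₁−k, n₂−k−1). -/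
/-- The value of `Q^k ψ` at `m` depends only on `ψ` at the points `m + (i, j)` with
`i, j ≥ 0` and `i + j ≤ k`. -/
theorem Qop_iterate_eq_zero_s17 (k : ℕ) (ψ : ℤ × ℤ → ℝ) (m : ℤ × ℤ)
    (h : ∀ i j : ℕ, i + j ≤ k → ψ (m.1 + i, m.2 + j) = 0) : Qop^[k] ψ m = 0 := by
  induction k generalizing ψ with
  | zero => simpa using h 0 0 le_rfl
  | succ k ih =>
    rw [Function.iterate_succ_apply]
    refine ih _ fun i j hij => ?_
    have h₀ := h i j (by omega)
    have h₁ := h (i + 1) j (by omega)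
    have h₂ := h i (j + 1) (by omega)
    push_cast [← add_assoc] at h₁ h₂
    simp [Qop, h₀, h₁, h₂]

/-- If `ψ` vanishes on the big black triangle `T_n^{(k)}`, then its `k`-th derivative
`Q^kψ` vanishes on the (ordinary) black triangle `T^b_{(n₁−k, n₂−k)}`, i.e. at the
three points `(n₁−k, n₂−k)`, `(n₁−k−1, n₂−k)`, `(n₁−k, n₂−k−1)`. -/
theorem kth_derivative_vanishes (k : ℕ) (n : ℤ × ℤ) (ψ : ℤ × ℤ → ℝ)
    (hψ : ∀ x ∈ bigT n k, ψ x = 0) :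
    Qop^[k] ψ (n.1 - k, n.2 - k) = 0 ∧
    Qop^[k] ψ (n.1 - k - 1, n.2 - k) = 0 ∧
    Qop^[k] ψ (n.1 - k, n.2 - k - 1) = 0 := by
  refine ⟨?_, ?_, ?_⟩
  · exact Qop_iterate_eq_zero_s17 k ψ _ fun i j hij =>
      hψ _ ⟨k - i, k - j, by omega, Prod.ext (by dsimp only; omega) (by dsimp only; omega)⟩
  · exact Qop_iterate_eq_zero_s17 k ψ _ fun i j hij =>
      hψ _ ⟨k + 1 - i, k - j, by omega, Prod.ext (by dsimp only; omega) (by dsimp only; omega)⟩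
  · exact Qop_iterate_eq_zero_s17 k ψ _ fun i j hij =>
      hψ _ ⟨k - i, k + 1 - j, by omega, Prod.ext (by dsimp only; omega) (by dsimp only; omega)⟩
end
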